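/- arXiv:1609.00317 — 10 statements merged into one kernel-verified Lean document; each statement's English description precedes it below -/
import Mathlib

section
/- Let γ̄ > 0, κ > 0 and let μ, m be positive integers with m < μ. Set Δ₁ = γ̄/(μ(1+κ)) and Δ₂ = ((μκ+m)/m)·γ̄/(μ(1+κ)). Then for every x > 0, the κ-μ shadowed density satisfies f_S(x) = Σ_{j=1}^{μ−m} A₁ⱼ · x^{μ−m−j} e^{−x/Δ₁} / ((μ−m−j)! · Δ₁^{μ−m−j+1}) + Σ_{j=1}^{m} A₂ⱼ · x^{m−j} e^{−x/Δ₂} / ((m−j)! · Δ₂^{m−j+1}), where A₁ⱼ = (−1)^m · C(m+j−2, j−1) · (m/(μκ+m))^m · (μκ/(μκ+m))^{−(m+j−1)} and A₂ⱼ = (−1)^{j−1} · C(μ−m+j−2, j−1) · (m/(μκ+m))^{j−1} · (μκ/(μκ+m))^{m−μ−j+1}; that is, f_S is a finite (improper) mixture of Gamma densities. -/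
open Real MeasureTheory Finset

/-- Rising factorial (Pochhammer symbol) `(a)ₙ = a(a+1)⋯(a+n−1)`. -/
noncomputable def risingFactorial (a : ℝ) (n : ℕ) : ℝ := ∏ i ∈ Finset.range n, (a + i)

/-- Confluent hypergeometric function `₁F₁(a; b; z) = Σ (a)ₙ/(b)ₙ zⁿ/n!`. -/
noncomputable def hyp1F1 (a b z : ℝ) : ℝ :=
  ∑' n : ℕ, risingFactorial a n / risingFactorial b n * z ^ n / (Nat.factorial n : ℝ)

/-- The κ-μ shadowed density with integer fading parameters μ, m. -/
noncomputable def kmuShadowedPDF (γ κ : ℝ) (μ m : ℕ) (x : ℝ) : ℝ :=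
  ((μ : ℝ) ^ μ * (m : ℝ) ^ m * (1 + κ) ^ μ) /
      ((Nat.factorial (μ - 1) : ℝ) * ((m : ℝ) + μ * κ) ^ m * γ) *
    (x / γ) ^ (μ - 1) * Real.exp (-(μ * (1 + κ) * x / γ)) *
    hyp1F1 m μ ((μ : ℝ) ^ 2 * κ * (1 + κ) * x / (((μ : ℝ) * κ + m) * γ))

/-- Truncated negative binomial sum against the exponential monomials `y ^ k / k!`. -/
noncomputable def negBinomSum (c y : ℝ) (N m : ℕ) : ℝ :=
  ∑ i ∈ Finset.range N, (Nat.choose (m + i - 1) i : ℝ) * c ^ (m + i) *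
    (y ^ (N - 1 - i) / (Nat.factorial (N - 1 - i) : ℝ))

lemma negBinomSum_zero_left (c y : ℝ) (m : ℕ) : negBinomSum c y 0 m = 0 := by
  simp [negBinomSum]

lemma negBinomSum_zero_right (c y : ℝ) (N : ℕ) :
    negBinomSum c y (N + 1) 0 = y ^ N / (Nat.factorial N : ℝ) := by
  rw [negBinomSum, Finset.sum_range_succ', Finset.sum_eq_zero]
  · simp
  · intro i _
    simp

lemma negBinomSum_succ_succ (c y : ℝ) (N m : ℕ) :
    negBinomSum c y (N + 1) (m + 1) =
      c * (negBinomSum c y (N + 1) m + negBinomSum c y N (m + 1)) := by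
  have hsplit : ∀ i, (Nat.choose (m + 1 + (i + 1) - 1) (i + 1) : ℝ) =
      Nat.choose (m + (i + 1) - 1) (i + 1) + Nat.choose (m + 1 + i - 1) i := by
    intro i
    rw [show m + 1 + (i + 1) - 1 = (m + i) + 1 by omega,
      show m + (i + 1) - 1 = m + i by omega, show m + 1 + i - 1 = m + i by omega,
      Nat.choose_succ_succ]
    push_cast
    ring
  have hcomm : ∀ u v w : ℝ, c * (u + v + w) = c * (u + w) + c * v := fun u v w => by ring
  simp only [negBinomSum]
  rw [Finset.sum_range_succ', Finset.sum_range_succ' _ N, hcomm,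
    ← Finset.sum_add_distrib, Finset.mul_sum]
  congr 1
  · refine Finset.sum_congr rfl fun i _ => ?_
    rw [hsplit, show N + 1 - 1 - (i + 1) = N - 1 - i by omega]
    ring
  · simp
    ring

lemma HasSum.of_eq {f g : ℕ → ℝ} {a b : ℝ} (h : HasSum f a) (hfg : ∀ n, g n = f n)
    (hab : b = a) : HasSum g b := by
  rw [hab]
  exact (funext hfg : g = f) ▸ h

/-- Partial fraction expansion of the confluent series `₁F₁(m; N + m; q y)`. -/
lemma hasSum_negBinom (q y : ℝ) (hq : q ≠ 0) (N m : ℕ) (h : 0 < N + m) :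
    HasSum (fun n : ℕ => (Nat.choose (m + n - 1) n : ℝ) * q ^ n *
        (y ^ (N + m - 1 + n) / (Nat.factorial (N + m - 1 + n) : ℝ)))
      ((-1) ^ m * negBinomSum q⁻¹ y N m +
        Real.exp (q * y) * ((-1) ^ N * negBinomSum (-q⁻¹) y m N)) := by
  induction N generalizing m with
  | zero =>
    obtain ⟨m, rfl⟩ : ∃ k, m = k + 1 := ⟨m - 1, by omega⟩
    rw [negBinomSum_zero_left, negBinomSum_zero_right]
    have hexp : HasSum (fun n : ℕ => (q * y) ^ n / (Nat.factorial n : ℝ)) (Real.exp (q * y)) := by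
      rw [Real.exp_eq_exp_ℝ]
      exact NormedSpace.expSeries_div_hasSum_exp (q * y)
    refine (hexp.mul_right (y ^ m / (Nat.factorial m : ℝ))).of_eq (fun n => ?_) ?_
    · have hc := Nat.add_choose_mul_factorial_mul_factorial m n
      rw [show m + 1 + n - 1 = m + n by omega, show 0 + (m + 1) - 1 + n = m + n by omega]
      have hc' : ((m + n).choose n : ℝ) * (m.factorial : ℝ) * (n.factorial : ℝ) =
          ((m + n).factorial : ℝ) := by exact_mod_cast hc
      have h1 : (m.factorial : ℝ) ≠ 0 := by positivity
      have h2 : (n.factorial : ℝ) ≠ 0 := by positivity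
      have h3 : ((m + n).choose n : ℝ) ≠ 0 := by
        exact_mod_cast (Nat.choose_pos (Nat.le_add_left n m)).ne'
      rw [← hc', mul_pow, pow_add]
      field_simp
    · simp
  | succ N ihN =>
    induction m with
    | zero =>
      rw [negBinomSum_zero_left, negBinomSum_zero_right]
      refine (hasSum_single (f := fun n : ℕ => (Nat.choose (0 + n - 1) n : ℝ) * q ^ n *
        (y ^ (N + 1 + 0 - 1 + n) / (Nat.factorial (N + 1 + 0 - 1 + n) : ℝ))) 0 ?_).of_eq (fun n => rfl) ?_
      · intro n hn
        rw [Nat.choose_eq_zero_of_lt (by omega)]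
        simp
      · simp
    | succ m ihm =>
      have hdiff := ((ihN (m + 1) (by omega)).sub (ihm (by omega)))
      have hshift := ((hasSum_nat_add_iff' 1).mpr hdiff).mul_left q⁻¹
      refine hshift.of_eq (fun n => ?_) ?_
      · have hp : ((m + n + 1).choose (n + 1) : ℝ) =
            (m + n).choose n + (m + n).choose (n + 1) := by
          rw [Nat.choose_succ_succ]
          push_cast
          ring
        rw [show m + 1 + (n + 1) - 1 = m + n + 1 by omega,
          show m + (n + 1) - 1 = m + n by omega, show m + 1 + n - 1 = m + n by omega,
          show N + (m + 1) - 1 + (n + 1) = N + m + 1 + n by omega,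
          show N + 1 + m - 1 + (n + 1) = N + m + 1 + n by omega,
          show N + 1 + (m + 1) - 1 + n = N + m + 1 + n by omega, hp]
        field_simp
        ring
      · rw [negBinomSum_succ_succ, negBinomSum_succ_succ]
        simp only [Finset.sum_range_one]
        rw [show N + (m + 1) - 1 + 0 = N + m by omega,
          show N + 1 + m - 1 + 0 = N + m by omega]
        simp only [Nat.choose_zero_right]
        ring

lemma risingFactorial_mul_factorial (a n : ℕ) (ha : 0 < a) :
    risingFactorial a n * (Nat.factorial (a - 1) : ℝ) = (Nat.factorial (a - 1 + n) : ℝ) := by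
  induction n with
  | zero => simp [risingFactorial]
  | succ n ih =>
    rw [risingFactorial, Finset.prod_range_succ, mul_right_comm, ← risingFactorial, ih,
      ← add_assoc, Nat.factorial_succ, show a - 1 + n + 1 = a + n by omega]
    push_cast
    ring

lemma hyp1F1_eq_negBinomSum (q y : ℝ) (hq : q ≠ 0) (N m : ℕ) (hm : 0 < m) :
    y ^ (N + m - 1) / (Nat.factorial (N + m - 1) : ℝ) * hyp1F1 m ((N + m : ℕ) : ℝ) (q * y) =
      (-1) ^ m * negBinomSum q⁻¹ y N m +
        Real.exp (q * y) * ((-1) ^ N * negBinomSum (-q⁻¹) y m N) := by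
  rw [← (hasSum_negBinom q y hq N m (by omega)).tsum_eq, hyp1F1, ← tsum_mul_left]
  refine tsum_congr fun n => ?_
  have h1 := risingFactorial_mul_factorial m n hm
  have h2 := risingFactorial_mul_factorial (N + m) n (by omega)
  have hc := Nat.add_choose_mul_factorial_mul_factorial (m - 1) n
  rw [show m - 1 + n = m + n - 1 by omega] at hc
  rw [show m - 1 + n = m + n - 1 by omega] at h1
  have hc' : ((m + n - 1).choose n : ℝ) * ((m - 1).factorial : ℝ) * (n.factorial : ℝ) =
      ((m + n - 1).factorial : ℝ) := by exact_mod_cast hc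
  have f1 : ((m - 1).factorial : ℝ) ≠ 0 := by positivity
  have f2 : (n.factorial : ℝ) ≠ 0 := by positivity
  have f3 : ((N + m - 1).factorial : ℝ) ≠ 0 := by positivity
  have f4 : ((N + m - 1 + n).factorial : ℝ) ≠ 0 := by positivity
  have e1 : risingFactorial m n = ((m + n - 1).choose n : ℝ) * (n.factorial : ℝ) := by
    apply mul_right_cancel₀ f1
    rw [h1, ← hc']
    ring
  have e2 : risingFactorial ((N + m : ℕ) : ℝ) n =
      ((N + m - 1 + n).factorial : ℝ) / ((N + m - 1).factorial : ℝ) := by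
    rw [eq_div_iff f3, h2]
  rw [e1, e2, mul_pow, pow_add]
  field_simp

theorem kmuShadowed_pdf_mixture_of_lt (γ κ : ℝ) (hγ : 0 < γ) (hκ : 0 < κ)
    (μ m : ℕ) (hμ : 0 < μ) (hm : 0 < m) (hmμ : m < μ) (Δ₁ Δ₂ : ℝ)
    (hΔ₁ : Δ₁ = γ / (μ * (1 + κ)))
    (hΔ₂ : Δ₂ = ((μ * κ + m) / m) * (γ / (μ * (1 + κ))))
    (A₁ A₂ : ℕ → ℝ)
    (hA₁ : ∀ j, A₁ j = (-1 : ℝ) ^ m * (Nat.choose (m + j - 2) (j - 1) : ℝ) *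
      ((m : ℝ) / (μ * κ + m)) ^ m *
      ((μ : ℝ) * κ / (μ * κ + m)) ^ (-((m : ℤ) + j - 1)))
    (hA₂ : ∀ j, A₂ j = (-1 : ℝ) ^ (j - 1) * (Nat.choose (μ - m + j - 2) (j - 1) : ℝ) *
      ((m : ℝ) / (μ * κ + m)) ^ (j - 1) *
      ((μ : ℝ) * κ / (μ * κ + m)) ^ ((m : ℤ) - μ - j + 1))
    (x : ℝ) (hx : 0 < x) :
    kmuShadowedPDF γ κ μ m x =
      (∑ j ∈ Finset.Icc 1 (μ - m),
        A₁ j * (x ^ (μ - m - j) * Real.exp (-x / Δ₁) /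
          ((Nat.factorial (μ - m - j) : ℝ) * Δ₁ ^ (μ - m - j + 1)))) +
      (∑ j ∈ Finset.Icc 1 m,
        A₂ j * (x ^ (m - j) * Real.exp (-x / Δ₂) /
          ((Nat.factorial (m - j) : ℝ) * Δ₂ ^ (m - j + 1)))) := by
  obtain ⟨N, rfl⟩ : ∃ N, μ = N + m := ⟨μ - m, by omega⟩
  simp only [Nat.add_sub_cancel] at hA₂ ⊢
  have hM : (0 : ℝ) < ((N + m : ℕ) : ℝ) := by exact_mod_cast hμ
  have hm' : (0 : ℝ) < m := by exact_mod_cast hm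
  set M : ℝ := ((N + m : ℕ) : ℝ) with hMdef
  have hD : 0 < M * κ + m := by positivity
  set p : ℝ := m / (M * κ + m) with hp
  set q : ℝ := M * κ / (M * κ + m) with hq
  have hp0 : 0 < p := by positivity
  have hq0 : 0 < q := by positivity
  have hpq : p + q = 1 := by rw [hp, hq]; field_simp; ring
  have hΔ₁0 : 0 < Δ₁ := by rw [hΔ₁]; positivity
  have hΔ₂' : Δ₂ = Δ₁ / p := by rw [hΔ₂, hΔ₁, hp]; field_simp
  set y : ℝ := x / Δ₁ with hy
  have hx' : x = y * Δ₁ := by rw [hy]; field_simp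
  have hexp : Real.exp (-y) * Real.exp (q * y) = Real.exp (-(p * y)) := by
    rw [← Real.exp_add]
    congr 1
    linear_combination y * hpq
  have hpdf : kmuShadowedPDF γ κ (N + m) m x = p ^ m / Δ₁ * Real.exp (-y) *
      (y ^ (N + m - 1) / (Nat.factorial (N + m - 1) : ℝ) *
        hyp1F1 m ((N + m : ℕ) : ℝ) (q * y)) := by
    have hy' : y = M * (1 + κ) * x / γ := by rw [hy, hΔ₁]; field_simp
    have harg : M ^ 2 * κ * (1 + κ) * x / ((M * κ + m) * γ) = q * y := by
      rw [hq, hy']; field_simp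
    have hpow : ∀ z : ℝ, z ^ (N + m) = z ^ (N + m - 1) * z := fun z => by
      rw [← pow_succ, Nat.sub_add_cancel hμ]
    have hpm : p ^ m = m ^ m / (M * κ + m) ^ m := by rw [hp, div_pow]
    rw [kmuShadowedPDF, ← hMdef, harg, ← hy', hpm, hΔ₁, hpow M, hpow (1 + κ),
      show y ^ (N + m - 1) = M ^ (N + m - 1) * (1 + κ) ^ (N + m - 1) * (x / γ) ^ (N + m - 1) by
        rw [← mul_pow, ← mul_pow, hy', mul_div_assoc],
      add_comm (m : ℝ) (M * κ)]
    field_simp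
  clear_value p q y
  rw [hpdf, hyp1F1_eq_negBinomSum q y hq0.ne' N m hm, mul_add]
  congr 1
  · rw [negBinomSum, ← Finset.Ico_add_one_right_eq_Icc, Finset.sum_Ico_eq_sum_range,
      Nat.add_sub_cancel, Finset.mul_sum, Finset.mul_sum]
    refine Finset.sum_congr rfl fun i _ => ?_
    rw [hA₁, show m + (1 + i) - 2 = m + i - 1 by omega, show 1 + i - 1 = i by omega,
      show N - (1 + i) = N - 1 - i by omega,
      show -((m : ℤ) + ((1 + i : ℕ) : ℤ) - 1) = -((m + i : ℕ) : ℤ) by push_cast; ring,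
      zpow_neg, zpow_natCast, neg_div, ← hy, hx', mul_pow, inv_pow, pow_succ Δ₁]
    field_simp
  · rw [negBinomSum, ← Finset.Ico_add_one_right_eq_Icc, Finset.sum_Ico_eq_sum_range,
      Nat.add_sub_cancel, Finset.mul_sum, Finset.mul_sum, Finset.mul_sum]
    refine Finset.sum_congr rfl fun i hi => ?_
    have hi' : i < m := Finset.mem_range.mp hi
    have hsign : ((-1 : ℝ)) ^ N * (-q⁻¹) ^ (N + i) = (-1) ^ i * (q ^ (N + i))⁻¹ := by
      rw [neg_pow q⁻¹, ← mul_assoc, pow_add (-1 : ℝ), ← mul_assoc, ← mul_pow, inv_pow]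
      norm_num
    have hxΔ : -x / Δ₂ = -(p * y) := by rw [hΔ₂', hy]; field_simp
    have hpm : p ^ m = p ^ i * p ^ (m - 1 - i + 1) := by
      rw [← pow_add]; congr 1; omega
    rw [hA₂, show N + (1 + i) - 2 = N + i - 1 by omega, show 1 + i - 1 = i by omega,
      show m - (1 + i) = m - 1 - i by omega,
      show (m : ℤ) - ((N + m : ℕ) : ℤ) - ((1 + i : ℕ) : ℤ) + 1 = -((N + i : ℕ) : ℤ) by
        push_cast; ring,
      zpow_neg, zpow_natCast, hxΔ, ← hexp, hΔ₂', hx', mul_pow, div_pow, hpm]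
    calc _ = p ^ i * p ^ (m - 1 - i + 1) / Δ₁ * Real.exp (-y) * Real.exp (q * y) *
          ((-1) ^ N * (-q⁻¹) ^ (N + i)) * (Nat.choose (N + i - 1) i : ℝ) *
          (y ^ (m - 1 - i) / (Nat.factorial (m - 1 - i) : ℝ)) := by ring
      _ = _ := by
        rw [hsign, pow_succ Δ₁]
        field_simp
end

section
/- Let γ̄ > 0, κ > 0 and let μ, m be positive integers with m ≥ μ. Set Δ₂ = ((μκ+m)/m)·γ̄/(μ(1+κ)). Then for every x > 0, the κ-μ shadowed density satisfies f_S(x) = Σ_{j=0}^{m−μ} B_j · x^{m−j−1} e^{−x/Δ₂} / ((m−j−1)! · Δ₂^{m−j}), where B_j = C(m−μ, j) · (m/(μκ+m))^j · (μκ/(μκ+m))^{m−μ−j}; that is, f_S is a proper finite mixture of Gamma densities with binomial mixture weights. -/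
open Real MeasureTheory Finset

/-- A symmetric form of Vandermonde's identity. -/
theorem sum_choose_mul_add_choose_add (N n c : ℕ) :
    ∑ k ∈ Finset.range (N + 1), N.choose k * (c + n).choose (c + k) =
      (N + (c + n)).choose n := by
  have hzero : ∀ M, N ≤ M ∨ n ≤ M → ∀ k, k ∉ Finset.range (M + 1) →
      N.choose k * (c + n).choose (c + k) = 0 := by
    intro M hM k hk
    rw [Finset.mem_range, not_lt] at hk
    rcases hM with h | h
    · rw [Nat.choose_eq_zero_of_lt (by omega : N < k), zero_mul]
    · rw [Nat.choose_eq_zero_of_lt (by omega : c + n < c + k), mul_zero]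
  have hN : Finset.range (N + 1) ⊆ Finset.range (N + n + 1) :=
    Finset.range_subset_range.2 (by omega)
  have hn : Finset.range (n + 1) ⊆ Finset.range (N + n + 1) :=
    Finset.range_subset_range.2 (by omega)
  rw [Finset.sum_subset hN fun k _ hk => hzero N (.inl le_rfl) k hk,
    ← Finset.sum_subset hn fun k _ hk => hzero n (.inr le_rfl) k hk,
    Nat.add_choose_eq,
    Finset.Nat.sum_antidiagonal_eq_sum_range_succ fun i j => N.choose i * (c + n).choose j]
  refine Finset.sum_congr rfl fun k hk => ?_
  have hk' : k ≤ n := Finset.mem_range_succ_iff.1 hk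
  rw [Nat.choose_symm_of_eq_add (by omega : c + n = (c + k) + (n - k))]

theorem descFactorial_mul_factorial_add (n c k : ℕ) :
    n.descFactorial k * (c + n).factorial =
      (c + n).choose (c + k) * n.factorial * (c + k).factorial := by
  rcases le_or_gt k n with h | h
  · obtain ⟨d, rfl⟩ := Nat.exists_eq_add_of_le h
    have h1 := Nat.choose_mul_factorial_mul_factorial (by omega : c + k ≤ c + (k + d))
    have h2 := Nat.factorial_mul_descFactorial h
    rw [show c + (k + d) - (c + k) = d by omega] at h1
    rw [show k + d - k = d by omega] at h2
    rw [← h1, ← h2]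
    ring
  · rw [Nat.descFactorial_eq_zero_iff_lt.2 h,
      Nat.choose_eq_zero_of_lt (by omega : c + n < c + k)]
    simp

theorem factorial_mul_risingFactorial_succ (c n : ℕ) :
    (c.factorial : ℝ) * risingFactorial ((c : ℝ) + 1) n = (c + n).factorial := by
  induction n with
  | zero => simp [risingFactorial]
  | succ n ih =>
    rw [risingFactorial, Finset.prod_range_succ, ← mul_assoc, ← risingFactorial, ih,
      ← Nat.add_assoc, Nat.factorial_succ]
    push_cast
    ring

theorem risingFactorial_succ_eq_div (c n : ℕ) :
    risingFactorial ((c : ℝ) + 1) n = (c + n).factorial / c.factorial := by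
  rw [eq_div_iff (by positivity), mul_comm, factorial_mul_risingFactorial_succ]

theorem sum_choose_mul_descFactorial_div_risingFactorial (N n c : ℕ) :
    ∑ k ∈ Finset.range (N + 1),
        (N.choose k : ℝ) * (n.descFactorial k / risingFactorial ((c : ℝ) + 1) k) =
      risingFactorial (((c + N : ℕ) : ℝ) + 1) n / risingFactorial ((c : ℝ) + 1) n := by
  have hterm : ∀ k, (N.choose k : ℝ) * (n.descFactorial k / risingFactorial ((c : ℝ) + 1) k) =
      ((N.choose k * (c + n).choose (c + k) : ℕ) : ℝ) *
        (n.factorial * c.factorial / (c + n).factorial) := by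
    intro k
    have h : (n.descFactorial k : ℝ) * (c + n).factorial =
        (c + n).choose (c + k) * n.factorial * (c + k).factorial := by
      exact_mod_cast descFactorial_mul_factorial_add n c k
    have h' : (n.descFactorial k : ℝ) =
        (c + n).choose (c + k) * n.factorial * (c + k).factorial / (c + n).factorial := by
      rw [eq_div_iff (by positivity), h]
    rw [risingFactorial_succ_eq_div, h']
    push_cast
    field_simp
  have hch : ((N + (c + n)).choose n : ℝ) * n.factorial * (c + N).factorial =
      (c + N + n).factorial := by
    have h := Nat.choose_mul_factorial_mul_factorial (by omega : n ≤ N + (c + n))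
    rw [show N + (c + n) - n = c + N by omega] at h
    rw [show c + N + n = N + (c + n) by omega]
    exact_mod_cast h
  rw [Finset.sum_congr rfl fun k _ => hterm k, ← Finset.sum_mul, ← Nat.cast_sum,
    sum_choose_mul_add_choose_add, risingFactorial_succ_eq_div, risingFactorial_succ_eq_div, ← hch]
  field_simp

theorem hasSum_descFactorial_mul_pow_div_factorial (z : ℝ) (k : ℕ) :
    HasSum (fun n : ℕ => (n.descFactorial k : ℝ) * (z ^ n / n.factorial))
      (z ^ k * Real.exp z) := by
  rw [← hasSum_nat_add_iff' k]
  have hzero : ∑ i ∈ Finset.range k, (i.descFactorial k : ℝ) * (z ^ i / i.factorial) = 0 :=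
    Finset.sum_eq_zero fun i hi => by
      rw [Nat.descFactorial_eq_zero_iff_lt.2 (Finset.mem_range.1 hi), Nat.cast_zero, zero_mul]
  have hexp : HasSum (fun n : ℕ => z ^ n / (n.factorial : ℝ)) (Real.exp z) := by
    rw [Real.exp_eq_exp_ℝ]
    exact NormedSpace.expSeries_div_hasSum_exp z
  rw [hzero, sub_zero]
  refine (hexp.mul_left (z ^ k)).congr_fun fun n => ?_
  have h : (n.factorial : ℝ) * (n + k).descFactorial k = (n + k).factorial := by
    have h := Nat.factorial_mul_descFactorial (Nat.le_add_left k n)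
    rw [Nat.add_sub_cancel] at h
    exact_mod_cast h
  have hpos : ((n + k).descFactorial k : ℝ) ≠ 0 := by
    intro h0
    rw [h0, mul_zero] at h
    exact (Nat.cast_ne_zero.2 (Nat.factorial_ne_zero _)) h.symm
  rw [← h, pow_add]
  field_simp

/-- Kummer's transformation for integer parameters: `₁F₁(b + N; b; z)` is `exp z` times a
polynomial of degree `N`. -/
theorem hyp1F1_add_nat (c N : ℕ) (z : ℝ) :
    hyp1F1 (((c + N : ℕ) : ℝ) + 1) ((c : ℝ) + 1) z =
      ∑ k ∈ Finset.range (N + 1),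
        (N.choose k : ℝ) / risingFactorial ((c : ℝ) + 1) k * (z ^ k * Real.exp z) := by
  refine HasSum.tsum_eq ?_
  refine (hasSum_sum fun k (_ : k ∈ Finset.range (N + 1)) =>
    (hasSum_descFactorial_mul_pow_div_factorial z k).mul_left
      ((N.choose k : ℝ) / risingFactorial ((c : ℝ) + 1) k)).congr_fun fun n => ?_
  rw [← sum_choose_mul_descFactorial_div_risingFactorial, mul_div_assoc, Finset.sum_mul]
  exact Finset.sum_congr rfl fun k _ => by ring

theorem kmuShadowed_pdf_mixture_of_ge (γ κ : ℝ) (hγ : 0 < γ) (hκ : 0 < κ)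
    (μ m : ℕ) (hμ : 0 < μ) (hm : 0 < m) (hmμ : μ ≤ m) (Δ₂ : ℝ)
    (hΔ₂ : Δ₂ = ((μ * κ + m) / m) * (γ / (μ * (1 + κ))))
    (B : ℕ → ℝ)
    (hB : ∀ j, B j = (Nat.choose (m - μ) j : ℝ) * ((m : ℝ) / (μ * κ + m)) ^ j *
      ((μ : ℝ) * κ / (μ * κ + m)) ^ (m - μ - j))
    (x : ℝ) (hx : 0 < x) :
    kmuShadowedPDF γ κ μ m x =
      ∑ j ∈ Finset.range (m - μ + 1),
        B j * (x ^ (m - j - 1) * Real.exp (-x / Δ₂) /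
          ((Nat.factorial (m - j - 1) : ℝ) * Δ₂ ^ (m - j))) := by
  obtain ⟨c, rfl⟩ : ∃ c, μ = c + 1 := ⟨μ - 1, by omega⟩
  obtain ⟨N, rfl⟩ := Nat.exists_eq_add_of_le hmμ
  have hcast : ((c + 1 + N : ℕ) : ℝ) = ((c + N : ℕ) : ℝ) + 1 := by push_cast; ring
  rw [kmuShadowedPDF, hcast, Nat.cast_succ c, hyp1F1_add_nat, ← hcast, ← Nat.cast_succ c,
    Finset.mul_sum, Nat.add_sub_cancel_left, ← Finset.sum_range_reflect]
  refine Finset.sum_congr rfl fun j hj => ?_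
  obtain ⟨k, rfl⟩ := Nat.exists_eq_add_of_le (Finset.mem_range_succ_iff.1 hj)
  rw [hB, Nat.add_sub_cancel_left, Nat.cast_succ c, risingFactorial_succ_eq_div,
    show j + k + 1 - 1 - j = k by omega, show c + 1 + (j + k) - j - 1 = c + k by omega,
    show c + 1 + (j + k) - j = c + 1 + k by omega, Nat.add_sub_cancel_left,
    Nat.choose_symm_add, Nat.add_sub_cancel]
  generalize hM : ((c + 1 + (j + k) : ℕ) : ℝ) = M at *
  have hMpos : 0 < M := by rw [← hM]; positivity
  rw [Nat.cast_succ c] at hΔ₂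
  generalize hb : (c : ℝ) + 1 = b at *
  have hbpos : 0 < b := by rw [← hb]; positivity
  have hs : 0 < b * κ + M := by positivity
  have hexp : Real.exp (-x / Δ₂) = Real.exp (-(b * (1 + κ) * x / γ)) *
      Real.exp (b ^ 2 * κ * (1 + κ) * x / ((b * κ + M) * γ)) := by
    rw [← Real.exp_add, hΔ₂]
    congr 1
    field_simp
    ring
  rw [hexp, hΔ₂, add_comm M (b * κ)]
  generalize b * κ + M = s at *
  simp only [div_pow, mul_pow, ← pow_mul, pow_add, pow_one]
  field_simp
  ring
end

section
/- Let γ̄ > 0, κ > 0 and let μ, m be positive integers with m < μ. Set Δ₁ = γ̄/(μ(1+κ)) and Δ₂ = ((μκ+m)/m)·γ̄/(μ(1+κ)). Then for every x ≥ 0, the κ-μ shadowed CDF satisfies ∫₀ˣ f_S(t) dt = 1 − Σ_{j=1}^{μ−m} A₁ⱼ e^{−x/Δ₁} Σ_{r=0}^{μ−m−j} (1/r!)(x/Δ₁)^r − Σ_{j=1}^{m} A₂ⱼ e^{−x/Δ₂} Σ_{r=0}^{m−j} (1/r!)(x/Δ₂)^r, where A₁ⱼ = (−1)^m · C(m+j−2,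 j−1) · (m/(μκ+m))^m · (μκ/(μκ+m))^{−(m+j−1)} and A₂ⱼ = (−1)^{j−1} · C(μ−m+j−2, j−1) · (m/(μκ+m))^{j−1} · (μκ/(μκ+m))^{m−μ−j+1}. -/
open Real MeasureTheory Finset

theorem choose_neg_natCast_succ (a k : ℕ) :
    Ring.choose (-((a + 1 : ℕ) : ℝ)) k = (-1) ^ k * ((a + k).choose k : ℝ) := by
  rw [Ring.choose_neg, show (((a + 1 : ℕ) : ℝ) + k - 1) = ((a + k : ℕ) : ℝ) by push_cast; ring,
    Ring.choose_natCast, Int.negOnePow_def]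
  simp [Units.smul_def]

/-- Chu–Vandermonde convolution with a negative upper index, `K ≤ N`. -/
theorem sum_neg_one_pow_mul_choose_of_le {K N : ℕ} (M : ℕ) (h : K ≤ N) :
    ∑ i ∈ Finset.range (M + 1), (-1 : ℝ) ^ i * (N + i).choose i * K.choose (M - i) =
      (-1) ^ M * (N - K + M).choose M := by
  have key := Ring.add_choose_eq (r := (-((N + 1 : ℕ) : ℝ))) (s := (K : ℝ)) M (Commute.all _ _)
  have hs : (-((N + 1 : ℕ) : ℝ)) + K = -((N - K + 1 : ℕ) : ℝ) := by
    push_cast [Nat.cast_sub h]; ring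
  rw [hs, choose_neg_natCast_succ, Finset.Nat.sum_antidiagonal_eq_sum_range_succ_mk] at key
  rw [key]
  exact Finset.sum_congr rfl fun i _ => by rw [choose_neg_natCast_succ, Ring.choose_natCast]

/-- Chu–Vandermonde convolution with a negative upper index, `N < K`. -/
theorem sum_neg_one_pow_mul_choose_add (M N k : ℕ) :
    ∑ i ∈ Finset.range (M + 1), (-1 : ℝ) ^ i * (N + i).choose i * (N + 1 + k).choose (M - i) =
      k.choose M := by
  have key := Ring.add_choose_eq (r := (-((N + 1 : ℕ) : ℝ))) (s := ((N + 1 + k : ℕ) : ℝ)) M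
    (Commute.all _ _)
  have hs : (-((N + 1 : ℕ) : ℝ)) + ((N + 1 + k : ℕ) : ℝ) = (k : ℝ) := by push_cast; ring
  rw [hs, Ring.choose_natCast, Finset.Nat.sum_antidiagonal_eq_sum_range_succ_mk] at key
  rw [key]
  exact Finset.sum_congr rfl fun i _ => by rw [choose_neg_natCast_succ, Ring.choose_natCast]

theorem risingFactorial_natCast_succ_mul_factorial (a n : ℕ) :
    risingFactorial ((a + 1 : ℕ) : ℝ) n * (a.factorial : ℝ) = ((a + n).factorial : ℝ) := by
  induction n with
  | zero => simp [risingFactorial]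
  | succ n ih =>
    rw [← add_assoc, Nat.factorial_succ, Nat.cast_mul, ← ih, risingFactorial,
      Finset.prod_range_succ, ← risingFactorial]
    push_cast
    ring

theorem hasSum_choose_mul_pow_div_factorial (j : ℕ) (w : ℝ) :
    HasSum (fun K : ℕ => (K.choose j : ℝ) * (w ^ K / K.factorial))
      (Real.exp w * (w ^ j / j.factorial)) := by
  rw [← hasSum_nat_add_iff' j, Finset.sum_eq_zero, sub_zero]
  · have h : HasSum (fun K : ℕ => w ^ K / (K.factorial : ℝ)) (Real.exp w) := by
      rw [Real.exp_eq_exp_ℝ]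
      exact NormedSpace.expSeries_div_hasSum_exp w
    refine (h.mul_right (w ^ j / (j.factorial : ℝ))).congr_fun fun K => ?_
    have hf : (((K + j).choose j : ℕ) : ℝ) * (K.factorial * j.factorial) =
        (K + j).factorial := by
      rw [← Nat.add_choose_mul_factorial_mul_factorial K j]
      push_cast
      ring
    have h1 : (K.factorial : ℝ) ≠ 0 := by positivity
    have h2 : (j.factorial : ℝ) ≠ 0 := by positivity
    have h3 : ((K + j).choose j : ℝ) ≠ 0 := by
      exact_mod_cast (Nat.choose_pos (Nat.le_add_left j K)).ne'
    rw [← hf]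
    field_simp
    ring
  · intro K hK
    simp [Nat.choose_eq_zero_of_lt (Finset.mem_range.mp hK)]

/-- Closed form of `₁F₁(M + 1; N + M + 2; w)` for natural numbers `M`, `N`. -/
theorem pow_mul_hyp1F1_natCast (M N : ℕ) (w : ℝ) :
    w ^ (N + M + 1) / ((N + M + 1).factorial : ℝ) *
        hyp1F1 ((M + 1 : ℕ) : ℝ) ((N + M + 1 + 1 : ℕ) : ℝ) w =
      (-1) ^ (M + 1) * ∑ i ∈ Finset.range (N + 1),
          ((M + i).choose i : ℝ) * (w ^ (N - i) / (N - i).factorial) +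
        Real.exp w * ∑ i ∈ Finset.range (M + 1),
          (-1) ^ i * ((N + i).choose i : ℝ) * (w ^ (M - i) / (M - i).factorial) := by
  have hsum : HasSum (fun K : ℕ => (∑ i ∈ Finset.range (M + 1),
        (-1 : ℝ) ^ i * (N + i).choose i * K.choose (M - i)) * (w ^ K / K.factorial))
      (Real.exp w * ∑ i ∈ Finset.range (M + 1),
        (-1) ^ i * ((N + i).choose i : ℝ) * (w ^ (M - i) / (M - i).factorial)) := by
    have h := hasSum_sum (s := Finset.range (M + 1)) fun i _ =>
      (hasSum_choose_mul_pow_div_factorial (M - i) w).mul_left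
        ((-1 : ℝ) ^ i * (N + i).choose i)
    simpa only [Finset.mul_sum, Finset.sum_mul, mul_assoc, mul_left_comm (Real.exp w)] using h
  rw [← hasSum_nat_add_iff' (N + 1 + M)] at hsum
  have hhead : ∑ K ∈ Finset.range (N + 1 + M), (∑ i ∈ Finset.range (M + 1),
        (-1 : ℝ) ^ i * (N + i).choose i * K.choose (M - i)) * (w ^ K / K.factorial) =
      (-1) ^ M * ∑ i ∈ Finset.range (N + 1),
          ((M + i).choose i : ℝ) * (w ^ (N - i) / (N - i).factorial) := by
    rw [Finset.sum_range_add, ← Finset.sum_range_reflect, Finset.mul_sum]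
    rw [Finset.sum_eq_zero (s := Finset.range M), add_zero]
    · refine Finset.sum_congr rfl fun i hi => ?_
      have hi' : i ≤ N := Nat.lt_succ_iff.mp (Finset.mem_range.mp hi)
      rw [show N + 1 - 1 - i = N - i by omega,
        sum_neg_one_pow_mul_choose_of_le M (Nat.sub_le N i), Nat.sub_sub_self hi',
        add_comm i M, Nat.choose_symm_add]
      ring
    · intro k hk
      rw [sum_neg_one_pow_mul_choose_add,
        Nat.choose_eq_zero_of_lt (Finset.mem_range.mp hk)]
      simp
  have hterm (n : ℕ) : (∑ i ∈ Finset.range (M + 1),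
        (-1 : ℝ) ^ i * (N + i).choose i * (n + (N + 1 + M)).choose (M - i)) *
          (w ^ (n + (N + 1 + M)) / (n + (N + 1 + M)).factorial) =
      w ^ (N + M + 1) / ((N + M + 1).factorial : ℝ) *
        (risingFactorial ((M + 1 : ℕ) : ℝ) n / risingFactorial ((N + M + 1 + 1 : ℕ) : ℝ) n *
          w ^ n / n.factorial) := by
    rw [show n + (N + 1 + M) = N + 1 + (M + n) by ring, sum_neg_one_pow_mul_choose_add]
    have h1 := risingFactorial_natCast_succ_mul_factorial M n
    have h2 := risingFactorial_natCast_succ_mul_factorial (N + M + 1) n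
    have h3 : (((M + n).choose M : ℕ) : ℝ) * (M.factorial * n.factorial) =
        (M + n).factorial := by
      rw [← Nat.add_choose_mul_factorial_mul_factorial M n, ← Nat.choose_symm_add]
      push_cast
      ring
    rw [show N + 1 + (M + n) = N + M + 1 + n by ring]
    have h4 : (M.factorial : ℝ) ≠ 0 := by positivity
    have h5 : (n.factorial : ℝ) ≠ 0 := by positivity
    have h6 : ((N + M + 1).factorial : ℝ) ≠ 0 := by positivity
    have h7 : ((N + M + 1 + n).factorial : ℝ) ≠ 0 := by positivity
    rw [← eq_div_iff h4] at h1
    rw [← eq_div_iff h6] at h2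
    rw [h1, h2, ← h3]
    field_simp
    ring
  simp_rw [hterm, hhead] at hsum
  rw [hyp1F1, ← tsum_mul_left, hsum.tsum_eq]
  ring

theorem one_sub_mul_sum_choose_mul_pow (M N : ℕ) (v : ℝ) :
    (1 - v) * ∑ i ∈ Finset.range (N + 1), ((M + 1 + i).choose i : ℝ) * v ^ i =
      ∑ i ∈ Finset.range (N + 1), ((M + i).choose i : ℝ) * v ^ i -
        ((M + 1 + N).choose N : ℝ) * v ^ (N + 1) := by
  induction N with
  | zero => simp
  | succ N ih =>
    rw [Finset.sum_range_succ, mul_add, ih, Finset.sum_range_succ _ (N + 1)]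
    have h : ((M + 1 + (N + 1)).choose (N + 1) : ℝ) =
        (M + 1 + N).choose N + (M + (N + 1)).choose (N + 1) := by
      rw [show M + 1 + (N + 1) = M + 1 + N + 1 by ring, Nat.choose_succ_succ,
        show M + (N + 1) = M + 1 + N by ring]
      push_cast
      ring
    rw [h]
    ring

/-- The Chaundy–Bullard identity. -/
theorem chaundy_bullard (M N : ℕ) {u v : ℝ} (h : u + v = 1) :
    u ^ (M + 1) * ∑ i ∈ Finset.range (N + 1), ((M + i).choose i : ℝ) * v ^ i +
      v ^ (N + 1) * ∑ i ∈ Finset.range (M + 1), ((N + i).choose i : ℝ) * u ^ i = 1 := by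
  obtain rfl : u = 1 - v := by linarith
  induction M with
  | zero =>
    have := mul_neg_geom_sum v (N + 1)
    simp [this]
  | succ M ih =>
    have h1 := one_sub_mul_sum_choose_mul_pow M N v
    have h2 : (N + (M + 1)).choose (M + 1) = (M + 1 + N).choose N := by
      rw [add_comm N, Nat.choose_symm_add]
    rw [Finset.sum_range_succ _ (M + 1), h2]
    linear_combination ih + (1 - v) ^ (M + 1) * h1

theorem hasDerivAt_exp_neg_mul_sum_pow_div_factorial (k : ℕ) (y : ℝ) :
    HasDerivAt (fun y : ℝ => Real.exp (-y) *
        ∑ r ∈ Finset.range (k + 1), (1 / (r.factorial : ℝ)) * y ^ r)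
      (-(Real.exp (-y) * (y ^ k / k.factorial))) y := by
  have hexp : HasDerivAt (fun y : ℝ => Real.exp (-y)) (-Real.exp (-y)) y := by
    simpa using (hasDerivAt_neg y).exp
  induction k with
  | zero => simpa using hexp
  | succ k ih =>
    have hpow : HasDerivAt (fun y : ℝ => Real.exp (-y) *
        ((1 / ((k + 1).factorial : ℝ)) * y ^ (k + 1))) _ y :=
      hexp.mul ((hasDerivAt_pow (k + 1) y).const_mul (1 / ((k + 1).factorial : ℝ)))
    have hsum := ih.add hpow
    refine (hsum.congr_of_eventuallyEq (Filter.Eventually.of_forall fun z => ?_)).congr_deriv ?_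
    · rw [Finset.sum_range_succ _ (k + 1), mul_add]
      rfl
    · have h1 : (k.factorial : ℝ) ≠ 0 := by positivity
      have h2 : (k : ℝ) + 1 ≠ 0 := by positivity
      rw [Nat.factorial_succ]
      push_cast
      field_simp
      ring

/-- The Erlang density is the derivative of minus the Erlang tail. -/
theorem hasDerivAt_erlang_tail (c : ℝ) (k : ℕ) (t : ℝ) :
    HasDerivAt (fun t : ℝ => Real.exp (-(c * t)) *
        ∑ r ∈ Finset.range (k + 1), (1 / (r.factorial : ℝ)) * (c * t) ^ r)
      (-(c * (Real.exp (-(c * t)) * ((c * t) ^ k / k.factorial)))) t := by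
  have h := (hasDerivAt_exp_neg_mul_sum_pow_div_factorial k (c * t)).comp t
    ((hasDerivAt_id t).const_mul c)
  exact h.congr_deriv (by simp; ring)

theorem sum_Icc_one_eq_sum_range (f : ℕ → ℝ) (n : ℕ) :
    ∑ j ∈ Finset.Icc 1 n, f j = ∑ i ∈ Finset.range n, f (i + 1) := by
  induction n with
  | zero => simp
  | succ n ih => rw [Finset.sum_Icc_succ_top (by omega), ih, Finset.sum_range_succ]

/-- For `m = M + 1` and `μ = N + M + 2`, the κ-μ shadowed density is a finite signed mixture of
Erlang densities. Here `a = μ(1+κ)/γ̄`, `p = m/(μκ+m)` and `q = 1 - p`. -/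
theorem kmuShadowedPDF_eq_erlang_mixture {γ κ : ℝ} (hγ : 0 < γ) (hκ : 0 < κ) (M N : ℕ)
    {a p q : ℝ} (ha : a = ((N + M + 1 + 1 : ℕ) : ℝ) * (1 + κ) / γ)
    (hp : p = ((M + 1 : ℕ) : ℝ) / (((N + M + 1 + 1 : ℕ) : ℝ) * κ + ((M + 1 : ℕ) : ℝ)))
    (hq : q = ((N + M + 1 + 1 : ℕ) : ℝ) * κ /
      (((N + M + 1 + 1 : ℕ) : ℝ) * κ + ((M + 1 : ℕ) : ℝ))) (t : ℝ) :
    kmuShadowedPDF γ κ (N + M + 1 + 1) (M + 1) t =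
      ∑ i ∈ Finset.range (N + 1), (-p / q) ^ (M + 1) * ((M + i).choose i : ℝ) * (1 / q) ^ i *
          (a * (Real.exp (-(a * t)) * ((a * t) ^ (N - i) / (N - i).factorial))) +
      ∑ i ∈ Finset.range (M + 1), (1 / q) ^ (N + 1) * ((N + i).choose i : ℝ) * (-p / q) ^ i *
          (a * p * (Real.exp (-(a * p * t)) * ((a * p * t) ^ (M - i) / (M - i).factorial))) := by
  have hden : 0 < ((N + M + 1 + 1 : ℕ) : ℝ) * κ + ((M + 1 : ℕ) : ℝ) := by positivity
  have hp0 : p ≠ 0 := by rw [hp]; positivity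
  have hq0 : q ≠ 0 := by rw [hq]; positivity
  have hpq : p + q = 1 := by rw [hp, hq]; field_simp; ring
  have key := pow_mul_hyp1F1_natCast M N (q * (a * t))
  have hpdf : kmuShadowedPDF γ κ (N + M + 1 + 1) (M + 1) t =
      a * p ^ (M + 1) * Real.exp (-(a * t)) / q ^ (N + M + 1) *
        ((q * (a * t)) ^ (N + M + 1) / ((N + M + 1).factorial : ℝ) *
        hyp1F1 ((M + 1 : ℕ) : ℝ) ((N + M + 1 + 1 : ℕ) : ℝ) (q * (a * t))) := by
    have hz : ((N + M + 1 + 1 : ℕ) : ℝ) ^ 2 * κ * (1 + κ) * t /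
        ((((N + M + 1 + 1 : ℕ) : ℝ) * κ + ((M + 1 : ℕ) : ℝ)) * γ) = q * (a * t) := by
      rw [hq, ha]; field_simp
    have he : ((N + M + 1 + 1 : ℕ) : ℝ) * (1 + κ) * t / γ = a * t := by
      rw [ha]; ring
    rw [kmuShadowedPDF, hz, he, Nat.add_sub_cancel]
    generalize hyp1F1 _ _ _ = H
    rw [mul_pow q, ha, hp, add_comm (((M + 1 : ℕ) : ℝ))]
    simp only [div_pow, mul_pow]
    field_simp
    ring
  rw [hpdf, key, mul_add]
  congr 1
  · rw [Finset.mul_sum, Finset.mul_sum]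
    refine Finset.sum_congr rfl fun i hi => ?_
    have hi' : i ≤ N := Nat.lt_succ_iff.mp (Finset.mem_range.mp hi)
    obtain ⟨d, rfl⟩ := Nat.exists_eq_add_of_le hi'
    rw [Nat.add_sub_cancel_left, neg_div, neg_pow (p / q), mul_pow q]
    simp only [div_pow, one_pow]
    field_simp
    ring
  · rw [Finset.mul_sum, Finset.mul_sum]
    refine Finset.sum_congr rfl fun i hi => ?_
    have hi' : i ≤ M := Nat.lt_succ_iff.mp (Finset.mem_range.mp hi)
    obtain ⟨d, rfl⟩ := Nat.exists_eq_add_of_le hi'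
    have he : Real.exp (-(a * p * t)) = Real.exp (-(a * t)) * Real.exp (q * (a * t)) := by
      rw [← Real.exp_add]
      congr 1
      linear_combination (-(a * t)) * hpq
    rw [Nat.add_sub_cancel_left, neg_div, neg_pow (p / q), mul_pow q, he, mul_right_comm a p t,
      mul_pow _ p]
    simp only [div_pow, one_pow]
    field_simp
    ring

theorem kmuShadowed_cdf_of_lt (γ κ : ℝ) (hγ : 0 < γ) (hκ : 0 < κ)
    (μ m : ℕ) (hμ : 0 < μ) (hm : 0 < m) (hmμ : m < μ) (Δ₁ Δ₂ : ℝ)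
    (hΔ₁ : Δ₁ = γ / (μ * (1 + κ)))
    (hΔ₂ : Δ₂ = ((μ * κ + m) / m) * (γ / (μ * (1 + κ))))
    (A₁ A₂ : ℕ → ℝ)
    (hA₁ : ∀ j, A₁ j = (-1 : ℝ) ^ m * (Nat.choose (m + j - 2) (j - 1) : ℝ) *
      ((m : ℝ) / (μ * κ + m)) ^ m *
      ((μ : ℝ) * κ / (μ * κ + m)) ^ (-((m : ℤ) + j - 1)))
    (hA₂ : ∀ j, A₂ j = (-1 : ℝ) ^ (j - 1) * (Nat.choose (μ - m + j - 2) (j - 1) : ℝ) *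
      ((m : ℝ) / (μ * κ + m)) ^ (j - 1) *
      ((μ : ℝ) * κ / (μ * κ + m)) ^ ((m : ℤ) - μ - j + 1))
    (x : ℝ) (hx : 0 ≤ x) :
    ∫ t in (0 : ℝ)..x, kmuShadowedPDF γ κ μ m t =
      1 - (∑ j ∈ Finset.Icc 1 (μ - m),
            A₁ j * Real.exp (-x / Δ₁) *
              ∑ r ∈ Finset.range (μ - m - j + 1), (1 / (Nat.factorial r : ℝ)) * (x / Δ₁) ^ r)
        - (∑ j ∈ Finset.Icc 1 m,
            A₂ j * Real.exp (-x / Δ₂) *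
              ∑ r ∈ Finset.range (m - j + 1), (1 / (Nat.factorial r : ℝ)) * (x / Δ₂) ^ r) := by
  obtain ⟨M, rfl⟩ : ∃ M, m = M + 1 := ⟨m - 1, by omega⟩
  obtain ⟨N, rfl⟩ : ∃ N, μ = N + M + 1 + 1 := ⟨μ - M - 2, by omega⟩
  obtain ⟨a, ha⟩ : ∃ a, a = ((N + M + 1 + 1 : ℕ) : ℝ) * (1 + κ) / γ := ⟨_, rfl⟩
  obtain ⟨p, hp⟩ : ∃ p, p = ((M + 1 : ℕ) : ℝ) /
    (((N + M + 1 + 1 : ℕ) : ℝ) * κ + ((M + 1 : ℕ) : ℝ)) := ⟨_, rfl⟩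
  obtain ⟨q, hq⟩ : ∃ q, q = ((N + M + 1 + 1 : ℕ) : ℝ) * κ /
    (((N + M + 1 + 1 : ℕ) : ℝ) * κ + ((M + 1 : ℕ) : ℝ)) := ⟨_, rfl⟩
  have hq0 : q ≠ 0 := by rw [hq]; positivity
  have hpq : p + q = 1 := by
    have hden : 0 < ((N + M + 1 + 1 : ℕ) : ℝ) * κ + ((M + 1 : ℕ) : ℝ) := by positivity
    rw [hp, hq]; field_simp; ring
  have hx₁ : x / Δ₁ = a * x := by rw [hΔ₁, ha]; field_simp
  have hx₂ : x / Δ₂ = a * p * x := by rw [hΔ₂, ha, hp]; field_simp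
  have hA₁' (i : ℕ) :
      A₁ (i + 1) = (-p / q) ^ (M + 1) * ((M + i).choose i : ℝ) * (1 / q) ^ i := by
    rw [hA₁, ← hp, ← hq, show M + 1 + (i + 1) - 2 = M + i by omega, Nat.add_sub_cancel,
      show (-(((M + 1 : ℕ) : ℤ) + ((i + 1 : ℕ) : ℤ) - 1)) = -((M + 1 + i : ℕ) : ℤ) by
        push_cast; ring,
      zpow_neg, zpow_natCast, neg_div, neg_pow (p / q), div_pow, div_pow, pow_add]
    field_simp
    simp
    ring
  have hA₂' (i : ℕ) :
      A₂ (i + 1) = (1 / q) ^ (N + 1) * ((N + i).choose i : ℝ) * (-p / q) ^ i := by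
    rw [hA₂, ← hp, ← hq, show N + M + 1 + 1 - (M + 1) + (i + 1) - 2 = N + i by omega,
      Nat.add_sub_cancel,
      show (((M + 1 : ℕ) : ℤ) - ((N + M + 1 + 1 : ℕ) : ℤ) - ((i + 1 : ℕ) : ℤ) + 1) =
        -((N + 1 + i : ℕ) : ℤ) by push_cast; ring,
      zpow_neg, zpow_natCast, neg_div, neg_pow (p / q), div_pow, div_pow, pow_add]
    field_simp
    simp
  let T (c : ℝ) (k : ℕ) (t : ℝ) : ℝ :=
    Real.exp (-(c * t)) * ∑ r ∈ Finset.range (k + 1), (1 / (r.factorial : ℝ)) * (c * t) ^ r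
  have hT0 (c : ℝ) (k : ℕ) : T c k 0 = 1 := by
    simp [T, Finset.sum_range_succ']
  let F (t : ℝ) : ℝ :=
    -(∑ i ∈ Finset.range (N + 1), A₁ (i + 1) * T a (N - i) t +
      ∑ i ∈ Finset.range (M + 1), A₂ (i + 1) * T (a * p) (M - i) t)
  have hpdf := kmuShadowedPDF_eq_erlang_mixture hγ hκ M N ha hp hq
  have hF (t : ℝ) : HasDerivAt F (kmuShadowedPDF γ κ (N + M + 1 + 1) (M + 1) t) t := by
    have h1 := HasDerivAt.fun_sum (u := Finset.range (N + 1)) fun i _ =>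
      (hasDerivAt_erlang_tail a (N - i) t).const_mul (A₁ (i + 1))
    have h2 := HasDerivAt.fun_sum (u := Finset.range (M + 1)) fun i _ =>
      (hasDerivAt_erlang_tail (a * p) (M - i) t).const_mul (A₂ (i + 1))
    refine (h1.add h2).neg.congr_deriv ?_
    rw [hpdf]
    simp only [mul_neg, Finset.sum_neg_distrib, hA₁', hA₂']
    ring
  have hcont : Continuous (kmuShadowedPDF γ κ (N + M + 1 + 1) (M + 1)) := by
    rw [funext hpdf]
    fun_prop
  have hF0 : F 0 = -1 := by
    have hcb := chaundy_bullard M N (u := -p / q) (v := 1 / q) (by field_simp; linarith)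
    rw [← hcb]
    simp only [F, hT0, hA₁', hA₂', mul_one, Finset.mul_sum, mul_assoc]
  rw [intervalIntegral.integral_eq_sub_of_hasDerivAt (fun t _ => hF t)
    (hcont.intervalIntegrable 0 x), hF0, sum_Icc_one_eq_sum_range, sum_Icc_one_eq_sum_range,
    show N + M + 1 + 1 - (M + 1) = N + 1 by omega]
  simp only [neg_div, hx₁, hx₂, Nat.add_sub_add_right, F, T, mul_assoc]
  ring
end

section
/- Let κ > 0 and let μ, m be positive integers with m < μ. Then the mixture coefficients of the κ-μ shadowed density sum to one: Σ_{j=1}^{μ−m} A₁ⱼ + Σ_{j=1}^{m} A₂ⱼ = 1, where A₁ⱼ = (−1)^m · C(m+j−2, j−1) · (m/(μκ+m))^m · (μκ/(μκ+m))^{−(m+j−1)} and A₂ⱼ = (−1)^{j−1} · C(μ−m+j−2, j−1) · (m/(μκ+m))^{j−1} · (μκ/(μκ+m))^{m−μ−j+1}. -/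
open Finset

/-- Pascal's rule, summed against a truncated geometric series. -/
theorem one_sub_mul_sum_choose_mul_pow_s4 {R : Type*} [CommRing R] (x : R) (a n : ℕ) :
    (1 - x) * ∑ i ∈ range (n + 1), ((a + 1 + i).choose i : R) * x ^ i =
      ∑ i ∈ range (n + 1), ((a + i).choose i : R) * x ^ i -
        ((a + n + 1).choose n : R) * x ^ (n + 1) := by
  induction n with
  | zero => simp
  | succ n ih =>
    rw [sum_range_succ, mul_add, ih, sum_range_succ _ (n + 1)]
    have h : (a + 1 + (n + 1)).choose (n + 1) =
        (a + n + 1).choose n + (a + (n + 1)).choose (n + 1) := by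
      rw [show a + 1 + (n + 1) = a + n + 1 + 1 by ring, Nat.choose_succ_succ]; rfl
    have h' : a + (n + 1) + 1 = a + 1 + (n + 1) := by ring
    rw [h', h]
    push_cast
    ring

/-- The Chaundy–Bullard identity. -/
theorem chaundy_bullard_s4 {R : Type*} [CommRing R] {x y : R} (hxy : x + y = 1) (a b : ℕ) :
    y ^ (a + 1) * ∑ i ∈ range (b + 1), ((a + i).choose i : R) * x ^ i +
      x ^ (b + 1) * ∑ i ∈ range (a + 1), ((b + i).choose i : R) * y ^ i = 1 := by
  obtain rfl : y = 1 - x := by rw [← hxy]; ring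
  induction a with
  | zero => simp [mul_neg_geom_sum]
  | succ a ih =>
    rw [pow_succ, mul_assoc, one_sub_mul_sum_choose_mul_pow_s4, sum_range_succ _ (a + 1)]
    have h : (b + (a + 1)).choose (a + 1) = (a + b + 1).choose b := by
      rw [show b + (a + 1) = a + b + 1 by ring]
      exact Nat.choose_symm_of_eq_add (by ring)
    rw [h]
    linear_combination ih

theorem kmuShadowed_mixture_coeffs_sum_to_one (κ : ℝ) (hκ : 0 < κ)
    (μ m : ℕ) (hμ : 0 < μ) (hm : 0 < m) (hmμ : m < μ)
    (A₁ A₂ : ℕ → ℝ)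
    (hA₁ : ∀ j, A₁ j = (-1 : ℝ) ^ m * (Nat.choose (m + j - 2) (j - 1) : ℝ) *
      ((m : ℝ) / (μ * κ + m)) ^ m *
      ((μ : ℝ) * κ / (μ * κ + m)) ^ (-((m : ℤ) + j - 1)))
    (hA₂ : ∀ j, A₂ j = (-1 : ℝ) ^ (j - 1) * (Nat.choose (μ - m + j - 2) (j - 1) : ℝ) *
      ((m : ℝ) / (μ * κ + m)) ^ (j - 1) *
      ((μ : ℝ) * κ / (μ * κ + m)) ^ ((m : ℤ) - μ - j + 1)) :
    (∑ j ∈ Finset.Icc 1 (μ - m), A₁ j) + (∑ j ∈ Finset.Icc 1 m, A₂ j) = 1 := by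
  obtain ⟨a, rfl⟩ : ∃ a, m = a + 1 := ⟨m - 1, by omega⟩
  obtain ⟨b, rfl⟩ : ∃ b, μ = a + 1 + (b + 1) := ⟨μ - (a + 1) - 1, by omega⟩
  have hsub : a + 1 + (b + 1) - (a + 1) = b + 1 := by omega
  rw [hsub]
  have hμκ : 0 < ((a + 1 + (b + 1) : ℕ) : ℝ) * κ := by positivity
  have hm' : (0 : ℝ) < ((a + 1 : ℕ) : ℝ) := by positivity
  set M : ℝ := ((a + 1 : ℕ) : ℝ)
  set K : ℝ := ((a + 1 + (b + 1) : ℕ) : ℝ) * κ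
  set p : ℝ := M / (K + M) with hp
  set q : ℝ := K / (K + M) with hq
  have hpq : q⁻¹ + -p * q⁻¹ = 1 := by
    rw [hp, hq]
    field_simp
    ring
  rw [← chaundy_bullard_s4 hpq a b, mul_sum, mul_sum, ← Ico_add_one_right_eq_Icc,
    ← Ico_add_one_right_eq_Icc, sum_Ico_eq_sum_range, sum_Ico_eq_sum_range]
  congr 1
  · refine sum_congr (by simp) fun i _ => ?_
    rw [hA₁, show a + 1 + (1 + i) - 2 = a + i by omega, show 1 + i - 1 = i by omega,
      show -(((a + 1 : ℕ) : ℤ) + ((1 + i : ℕ) : ℤ) - 1) = -((a + 1 + i : ℕ) : ℤ) by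
        push_cast; ring, zpow_neg, zpow_natCast, ← inv_pow, neg_mul, neg_pow (p * q⁻¹)]
    ring
  · refine sum_congr (by simp) fun i _ => ?_
    rw [hA₂, show a + 1 + (b + 1) - (a + 1) + (1 + i) - 2 = b + i by omega,
      show 1 + i - 1 = i by omega,
      show ((a + 1 : ℕ) : ℤ) - ((a + 1 + (b + 1) : ℕ) : ℤ) - ((1 + i : ℕ) : ℤ) + 1 =
        -((b + 1 + i : ℕ) : ℤ) by push_cast; ring,
      zpow_neg, zpow_natCast, ← inv_pow, neg_mul, neg_pow (p * q⁻¹)]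
    ring
end

section
/- Let γ̄ > 0, κ > 0, let μ, m be positive integers, and set Δ₁ = γ̄/(μ(1+κ)) and Δ₂ = ((μκ+m)/m)·γ̄/(μ(1+κ)). Then for every real s with s < 1/Δ₂, the moment generating function of the κ-μ shadowed distribution satisfies ∫₀^∞ e^{s x} f_S(x) dx = (1 − Δ₁ s)^{m−μ} / (1 − Δ₂ s)^m. -/
open Real MeasureTheory Finset

theorem risingFactorial_natCast_add_one (k n : ℕ) :
    risingFactorial ((k + 1 : ℕ) : ℝ) n = ((n + k).factorial : ℝ) / k.factorial := by
  have hk : (k.factorial : ℝ) ≠ 0 := by positivity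
  rw [eq_div_iff hk]
  induction n with
  | zero => simp [risingFactorial]
  | succ n ih =>
    rw [risingFactorial, Finset.prod_range_succ, ← risingFactorial, mul_right_comm, ih,
      show n + 1 + k = (n + k) + 1 by ring, Nat.factorial_succ]
    push_cast
    ring

theorem integral_pow_mul_exp_neg_mul_Ioi (n : ℕ) {p : ℝ} (hp : 0 < p) :
    ∫ x in Set.Ioi (0 : ℝ), x ^ n * Real.exp (-(p * x)) = n.factorial / p ^ (n + 1) := by
  have h := Real.integral_rpow_mul_exp_neg_mul_Ioi (a := (n : ℝ) + 1) (by positivity) hp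
  rw [Real.Gamma_nat_eq_factorial] at h
  simp only [add_sub_cancel_right, Real.rpow_natCast] at h
  rw [h, ← Nat.cast_succ, Real.rpow_natCast, one_div, inv_pow, mul_comm, div_eq_mul_inv]

theorem integrableOn_pow_mul_exp_neg_mul_Ioi (n : ℕ) {p : ℝ} (hp : 0 < p) :
    IntegrableOn (fun x : ℝ ↦ x ^ n * Real.exp (-(p * x))) (Set.Ioi 0) := by
  refine Integrable.of_integral_ne_zero ?_
  rw [integral_pow_mul_exp_neg_mul_Ioi n hp]
  positivity

/-- The Laplace transform of `x ^ j * ₁F₁(k + 1; j + 1; c x)`. -/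
theorem integral_pow_mul_exp_mul_hyp1F1 (j k : ℕ) {c p : ℝ} (hc : 0 ≤ c) (hcp : c < p) :
    ∫ x in Set.Ioi (0 : ℝ), x ^ j * Real.exp (-(p * x)) *
        hyp1F1 ((k + 1 : ℕ) : ℝ) ((j + 1 : ℕ) : ℝ) (c * x) =
      j.factorial / p ^ (j + 1) * (1 / (1 - c / p) ^ (k + 1)) := by
  have hp : 0 < p := hc.trans_lt hcp
  set a : ℕ → ℝ := fun n ↦ risingFactorial ((k + 1 : ℕ) : ℝ) n /
    risingFactorial ((j + 1 : ℕ) : ℝ) n * c ^ n / n.factorial with ha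
  have ha_nonneg (n : ℕ) : 0 ≤ a n := by
    simp only [ha, risingFactorial_natCast_add_one]
    positivity
  let F : ℕ → ℝ → ℝ := fun n x ↦ a n * (x ^ (n + j) * Real.exp (-(p * x)))
  have hF_int (n : ℕ) : Integrable (F n) (volume.restrict (Set.Ioi 0)) :=
    (integrableOn_pow_mul_exp_neg_mul_Ioi (n + j) hp).const_mul _
  have hF_eq (n : ℕ) : ∫ x in Set.Ioi (0 : ℝ), F n x =
      j.factorial / p ^ (j + 1) * ((n + k).choose k * (c / p) ^ n) := by
    simp only [F]
    rw [integral_const_mul, integral_pow_mul_exp_neg_mul_Ioi _ hp, ← Nat.choose_symm_add,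
      Nat.cast_add_choose, div_pow]
    simp only [ha, risingFactorial_natCast_add_one]
    field_simp
    ring
  have hF_norm (n : ℕ) : ∫ x in Set.Ioi (0 : ℝ), ‖F n x‖ = ∫ x in Set.Ioi (0 : ℝ), F n x := by
    refine setIntegral_congr_fun measurableSet_Ioi fun x (hx : 0 < x) ↦ ?_
    exact Real.norm_of_nonneg (mul_nonneg (ha_nonneg n) (by positivity))
  have hr : ‖c / p‖ < 1 := by
    rw [Real.norm_of_nonneg (by positivity)]
    exact (div_lt_one hp).2 hcp
  have hsum : HasSum (fun n ↦ ∫ x in Set.Ioi (0 : ℝ), F n x)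
      (j.factorial / p ^ (j + 1) * (1 / (1 - c / p) ^ (k + 1))) := by
    simp only [hF_eq]
    exact (hasSum_choose_mul_geometric_of_norm_lt_one k hr).mul_left _
  have hint := hasSum_integral_of_summable_integral_norm hF_int
    (by simpa only [hF_norm] using hsum.summable)
  rw [← hint.unique hsum]
  congr 1 with x
  rw [hyp1F1, ← tsum_mul_left]
  congr 1 with n
  simp only [F, ha]
  ring

theorem kmuShadowed_mgf (γ κ : ℝ) (hγ : 0 < γ) (hκ : 0 < κ)
    (μ m : ℕ) (hμ : 0 < μ) (hm : 0 < m) (Δ₁ Δ₂ : ℝ)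
    (hΔ₁ : Δ₁ = γ / (μ * (1 + κ)))
    (hΔ₂ : Δ₂ = ((μ * κ + m) / m) * (γ / (μ * (1 + κ))))
    (s : ℝ) (hs : s < 1 / Δ₂) :
    ∫ x in Set.Ioi (0 : ℝ), Real.exp (s * x) * kmuShadowedPDF γ κ μ m x =
      (1 - Δ₁ * s) ^ ((m : ℤ) - μ) / (1 - Δ₂ * s) ^ m := by
  obtain ⟨j, rfl⟩ : ∃ j, μ = j + 1 := ⟨μ - 1, by omega⟩
  obtain ⟨k, rfl⟩ : ∃ k, m = k + 1 := ⟨m - 1, by omega⟩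
  generalize hM : ((j + 1 : ℕ) : ℝ) = M at *
  generalize hK : ((k + 1 : ℕ) : ℝ) = K at *
  have hM0 : 0 < M := hM ▸ by positivity
  have hK0 : 0 < K := hK ▸ by positivity
  set β : ℝ := M * (1 + κ) / γ with hβ
  set c : ℝ := M ^ 2 * κ * (1 + κ) / ((M * κ + K) * γ) with hc
  have hβ0 : 0 < β := by positivity
  have hc0 : 0 < c := by positivity
  have hβc : β - c = 1 / Δ₂ := by
    rw [hΔ₂, hβ, hc]
    field_simp
    ring
  have hcp : c < β - s := by linarith
  have hp0 : 0 < β - s := hc0.trans hcp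
  have hpc0 : 0 < β - s - c := by linarith
  have hint : ∫ x in Set.Ioi (0 : ℝ), Real.exp (s * x) * kmuShadowedPDF γ κ (j + 1) (k + 1) x =
      β ^ (j + 1) * (K / (K + M * κ)) ^ (k + 1) / j.factorial *
        (j.factorial / (β - s) ^ (j + 1) * (1 / (1 - c / (β - s)) ^ (k + 1))) := by
    rw [← integral_pow_mul_exp_mul_hyp1F1 j k hc0.le hcp, ← integral_const_mul]
    congr 1 with x
    have hexp : Real.exp (-((β - s) * x)) =
        Real.exp (s * x) * Real.exp (-(M * (1 + κ) * x / γ)) := by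
      rw [← Real.exp_add, hβ]
      congr 1
      ring
    have harg : M ^ 2 * κ * (1 + κ) * x / ((M * κ + K) * γ) = c * x := by
      rw [hc]
      ring
    rw [kmuShadowedPDF, hexp, hM, hK, harg, Nat.add_sub_cancel, hβ, div_pow, div_pow, div_pow,
      mul_pow]
    field_simp
    ring
  have hΔ₁s : 1 - Δ₁ * s = (β - s) / β := by
    rw [hΔ₁, hβ]
    field_simp
  have hΔ₂0 : 0 < Δ₂ := by
    rw [hΔ₂]
    positivity
  have hΔ₂s : 1 - Δ₂ * s = (β - s - c) / (β - c) := by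
    rw [sub_right_comm, hβc]
    field_simp
  have hratio : K / (K + M * κ) = (β - c) / β := by
    rw [hβ, hc]
    field_simp
    ring
  have hβc0 : 0 < β - c := by
    rw [hβc]
    positivity
  have hgeom : 1 - c / (β - s) = (β - s - c) / (β - s) := by
    field_simp
  rw [hint, hΔ₁s, hΔ₂s, hratio, hgeom, zpow_sub₀ (by positivity), zpow_natCast, zpow_natCast]
  clear_value β c
  generalize β - s - c = q at *
  generalize β - c = b at *
  generalize β - s = p at *
  simp only [div_pow]
  field_simp
end

section
/- Let p, q be positive integers and let a, b be nonzero real numbers with a ≠ b. Then for every real s with a·s ≠ 1 and b·s ≠ 1, the following partial fraction expansion holds: 1/((1 − a s)^p (1 − b s)^q) = Σ_{j=1}^{p} [(−1)^{j−1} C(q+j−2, j−1) · b^{j−1} a^{q} / (a − b)^{q+j−1}] · (1 − a s)^{−(p−j+1)} + Σ_{j=1}^{q} [(−1)^{j−1} C(p+j−2, j−1) · a^{j−1} b^{p} / (b − a)^{p+j−1}] · (1 − b s)^{−(q−j+1)}. -/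
open Finset

/-- One of the two principal parts in the expansion of `x ^ p * y ^ q` when
`x * y = u * x + v * y`. -/
def principalPart {R : Type*} [CommSemiring R] (u v x : R) (p q : ℕ) : R :=
  ∑ i ∈ Finset.range p, ((q + i - 1).choose i : R) * v ^ i * u ^ q * x ^ (p - i)

theorem principalPart_zero_left {R : Type*} [CommSemiring R] (u v x : R) (q : ℕ) :
    principalPart u v x 0 q = 0 := by
  simp [principalPart]

theorem principalPart_succ_zero {R : Type*} [CommSemiring R] (u v x : R) (p : ℕ) :
    principalPart u v x (p + 1) 0 = x ^ (p + 1) := by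
  simp [principalPart, Finset.sum_range_succ']

theorem principalPart_succ_succ {R : Type*} [CommSemiring R] (u v x : R) (p q : ℕ) :
    principalPart u v x (p + 1) (q + 1) =
      u * principalPart u v x (p + 1) q + v * principalPart u v x p (q + 1) := by
  have key : ∀ i ∈ Finset.range p,
      ((q + 1 + (i + 1) - 1).choose (i + 1) : R) * v ^ (i + 1) * u ^ (q + 1) *
          x ^ (p + 1 - (i + 1)) =
        u * (((q + (i + 1) - 1).choose (i + 1) : R) * v ^ (i + 1) * u ^ q *
          x ^ (p + 1 - (i + 1))) +
        v * (((q + 1 + i - 1).choose i : R) * v ^ i * u ^ (q + 1) * x ^ (p - i)) := by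
    intro i _
    rw [show q + 1 + (i + 1) - 1 = (q + i) + 1 by omega, show q + (i + 1) - 1 = q + i by omega,
      show q + 1 + i - 1 = q + i by omega, show p + 1 - (i + 1) = p - i by omega,
      Nat.choose_succ_succ]
    push_cast
    ring
  unfold principalPart
  rw [Finset.sum_range_succ', Finset.sum_range_succ', Finset.sum_congr rfl key,
    Finset.sum_add_distrib, mul_add, Finset.mul_sum, Finset.mul_sum]
  simp only [Nat.choose_zero_right, Nat.cast_one, pow_zero]
  ring

theorem pow_mul_pow_eq_principalPart_add {R : Type*} [CommSemiring R] {u v x y : R}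
    (h : x * y = u * x + v * y) (p q : ℕ) (hpq : 0 < p + q) :
    x ^ p * y ^ q = principalPart u v x p q + principalPart v u y q p := by
  induction p generalizing q with
  | zero =>
    obtain ⟨q, rfl⟩ : ∃ k, q = k + 1 := ⟨q - 1, by omega⟩
    simp [principalPart_zero_left, principalPart_succ_zero]
  | succ p ihp =>
    induction q with
    | zero => simp [principalPart_zero_left, principalPart_succ_zero]
    | succ q ihq =>
      calc x ^ (p + 1) * y ^ (q + 1) = x ^ p * y ^ q * (x * y) := by ring
        _ = u * (x ^ (p + 1) * y ^ q) + v * (x ^ p * y ^ (q + 1)) := by rw [h]; ring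
        _ = _ := by
          rw [ihq (by omega), ihp (q + 1) (by omega), principalPart_succ_succ,
            principalPart_succ_succ]
          ring

theorem sum_Icc_eq_principalPart {K : Type*} [Field K] (p q : ℕ) (a b x : K) :
    (∑ j ∈ Finset.Icc 1 p,
        ((-1 : K) ^ (j - 1) * (Nat.choose (q + j - 2) (j - 1) : K) * b ^ (j - 1) * a ^ q /
          (a - b) ^ (q + j - 1)) * x ^ (-((p : ℤ) - j + 1))) =
      principalPart (a / (a - b)) (b / (b - a)) x⁻¹ p q := by
  unfold principalPart
  rw [← Finset.Ico_add_one_right_eq_Icc, Finset.sum_Ico_eq_sum_range, Nat.add_sub_cancel]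
  refine Finset.sum_congr rfl fun i hi => ?_
  have hip : i < p := Finset.mem_range.mp hi
  have hexp : -((p : ℤ) - ((1 + i : ℕ) : ℤ) + 1) = -((p - i : ℕ) : ℤ) := by omega
  have hneg : b / (b - a) = -1 * b / (a - b) := by
    rw [← neg_sub a b, div_neg, neg_one_mul, neg_div]
  rw [hexp, zpow_neg, zpow_natCast, inv_pow, hneg, div_pow, div_pow, mul_pow,
    show 1 + i - 1 = i by omega, show q + (1 + i) - 2 = q + i - 1 by omega,
    show q + (1 + i) - 1 = q + i by omega, pow_add]
  simp only [div_eq_mul_inv, mul_inv]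
  ring

theorem partial_fraction_expansion (p q : ℕ) (hp : 0 < p) (hq : 0 < q)
    (a b : ℝ) (ha : a ≠ 0) (hb : b ≠ 0) (hab : a ≠ b)
    (s : ℝ) (has : a * s ≠ 1) (hbs : b * s ≠ 1) :
    1 / ((1 - a * s) ^ p * (1 - b * s) ^ q) =
      (∑ j ∈ Finset.Icc 1 p,
        ((-1 : ℝ) ^ (j - 1) * (Nat.choose (q + j - 2) (j - 1) : ℝ) * b ^ (j - 1) * a ^ q /
          (a - b) ^ (q + j - 1)) * (1 - a * s) ^ (-((p : ℤ) - j + 1))) +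
      (∑ j ∈ Finset.Icc 1 q,
        ((-1 : ℝ) ^ (j - 1) * (Nat.choose (p + j - 2) (j - 1) : ℝ) * a ^ (j - 1) * b ^ p /
          (b - a) ^ (p + j - 1)) * (1 - b * s) ^ (-((q : ℤ) - j + 1))) := by
  have hx : 1 - a * s ≠ 0 := sub_ne_zero.mpr has.symm
  have hy : 1 - b * s ≠ 0 := sub_ne_zero.mpr hbs.symm
  have hd : a - b ≠ 0 := sub_ne_zero.mpr hab
  have h : (1 - a * s)⁻¹ * (1 - b * s)⁻¹ =
      a / (a - b) * (1 - a * s)⁻¹ + b / (b - a) * (1 - b * s)⁻¹ := by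
    have hrel : a * (1 - b * s) - b * (1 - a * s) = a - b := by ring
    generalize 1 - a * s = x at *
    generalize 1 - b * s = y at *
    rw [← neg_sub a b]
    field_simp
    linear_combination -hrel
  rw [sum_Icc_eq_principalPart p q, sum_Icc_eq_principalPart q p,
    ← pow_mul_pow_eq_principalPart_add h p q (by omega), inv_pow, inv_pow, one_div, mul_inv]
end

section
/- Let m be a positive integer, let n be a natural number with n ≤ m − 1, and let c be a nonzero real number. Then the n-th derivative of the function x ↦ x^{m−1} e^{x/c} satisfies, for every real x: d^n/dx^n [x^{m−1} e^{x/c}] = Σ_{r=0}^{n} C(n, r) · ((m−1)!/(m−1−r)!) · x^{m−1−r} · c^{r−n} · e^{x/c}. -/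
open Finset

theorem Nat.cast_descFactorial_eq_div {k n : ℕ} (h : k ≤ n) :
    (n.descFactorial k : ℝ) = (n.factorial : ℝ) / ((n - k).factorial : ℝ) := by
  rw [eq_div_iff (by positivity), mul_comm]
  exact_mod_cast Nat.factorial_mul_descFactorial h

theorem iteratedDeriv_exp_div_const (n : ℕ) (c x : ℝ) :
    iteratedDeriv n (fun y : ℝ => Real.exp (y / c)) x = c⁻¹ ^ n * Real.exp (x / c) := by
  simpa only [div_eq_inv_mul] using congrFun (iteratedDeriv_exp_const_mul n c⁻¹) x

theorem iteratedDeriv_pow_mul_exp (m : ℕ) (hm : 0 < m) (n : ℕ) (hn : n ≤ m - 1)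
    (c : ℝ) (hc : c ≠ 0) (x : ℝ) :
    iteratedDeriv n (fun y : ℝ => y ^ (m - 1) * Real.exp (y / c)) x =
      ∑ r ∈ Finset.range (n + 1),
        (Nat.choose n r : ℝ) * ((Nat.factorial (m - 1) : ℝ) / (Nat.factorial (m - 1 - r) : ℝ)) *
          x ^ (m - 1 - r) * c ^ ((r : ℤ) - n) * Real.exp (x / c) := by
  rw [iteratedDeriv_fun_mul (by fun_prop) (by fun_prop)]
  refine Finset.sum_congr rfl fun r hr => ?_
  have hrn : r ≤ n := Finset.mem_range_succ_iff.mp hr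
  have hpow : c⁻¹ ^ (n - r) = c ^ ((r : ℤ) - n) := by
    rw [inv_pow, ← zpow_natCast, ← zpow_neg, Nat.cast_sub hrn, neg_sub]
  rw [iteratedDeriv_pow, iteratedDeriv_exp_div_const, hpow,
    Nat.cast_descFactorial_eq_div (hrn.trans hn)]
  ring
end

section
/- Let γ̄ > 0, κ > 0 and let μ, m be positive integers with m < μ. Set Δ₁ = γ̄/(μ(1+κ)) and Δ₂ = ((μκ+m)/m)·γ̄/(μ(1+κ)). Then for every x > 0, the convolution of the Gamma(μ−m, Δ₁) density and the Gamma(m, Δ₂) density equals the κ-μ shadowed density: ∫₀ˣ [t^{μ−m−1} e^{−t/Δ₁} / ((μ−m−1)! Δ₁^{μ−m})] · [(x−t)^{m−1} e^{−(x−t)/Δ₂} / ((m−1)! Δ₂^{m})] dt = f_S(x). In other words, a κ-μ shadowed random variable with m < μ is distributed as the sum of two independent Gamma random variables with shape parameters μ−m and m and scale parameters Δ₁ and Δ₂. -/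
open Real MeasureTheory Finset

theorem risingFactorial_natCast_succ (k n : ℕ) :
    risingFactorial ((k : ℝ) + 1) n = (Nat.factorial (k + n) : ℝ) / Nat.factorial k := by
  rw [eq_div_iff (by positivity)]
  induction n with
  | zero => simp [risingFactorial]
  | succ n ih =>
    rw [risingFactorial, Finset.prod_range_succ, ← risingFactorial, mul_right_comm, ih,
      ← add_assoc, Nat.factorial_succ]
    push_cast
    ring

/-- Euler's beta integral on `[0, x]` with natural number exponents. -/
theorem integral_pow_mul_sub_pow (a b : ℕ) (x : ℝ) :
    ∫ t in (0 : ℝ)..x, t ^ a * (x - t) ^ b =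
      (Nat.factorial a * Nat.factorial b : ℝ) / Nat.factorial (a + b + 1) *
        x ^ (a + b + 1) := by
  induction a generalizing b with
  | zero =>
    have h := intervalIntegral.integral_comp_sub_left (a := 0) (b := x) (fun t : ℝ => t ^ b) x
    simp only [pow_zero, one_mul, h, sub_self, sub_zero, integral_pow, zero_add,
      Nat.factorial_zero, Nat.factorial_succ]
    push_cast
    field_simp
    simp
  | succ a ih =>
    have hu : ∀ t ∈ Set.uIcc 0 x,
        HasDerivAt (fun t : ℝ => t ^ (a + 1)) (((a : ℝ) + 1) * t ^ a) t := fun t _ => by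
      simpa using hasDerivAt_pow (a + 1) t
    have hv : ∀ t ∈ Set.uIcc 0 x,
        HasDerivAt (fun t : ℝ => -((x - t) ^ (b + 1) / ((b : ℝ) + 1))) ((x - t) ^ b) t :=
      fun t _ => by
        have h := ((((hasDerivAt_id t).const_sub x).pow (b + 1)).div_const ((b : ℝ) + 1)).neg
        refine h.congr_deriv ?_
        simp only [id, Nat.add_sub_cancel]
        push_cast
        field_simp
    rw [intervalIntegral.integral_mul_deriv_eq_deriv_mul hu hv
      (Continuous.intervalIntegrable (by fun_prop) _ _)
      (Continuous.intervalIntegrable (by fun_prop) _ _)]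
    have h : ∀ t : ℝ, ((a : ℝ) + 1) * t ^ a * -((x - t) ^ (b + 1) / ((b : ℝ) + 1)) =
        -(((a : ℝ) + 1) / (b + 1)) * (t ^ a * (x - t) ^ (b + 1)) := fun t => by
      field_simp
    simp only [h, intervalIntegral.integral_const_mul, ih, sub_self]
    rw [show a + (b + 1) + 1 = a + 1 + b + 1 by ring, Nat.factorial_succ a, Nat.factorial_succ b]
    push_cast
    field_simp
    simp

/-- Euler's integral representation of `₁F₁` at positive integer parameters. -/
theorem integral_pow_mul_sub_pow_mul_exp (a b : ℕ) (w : ℝ) {x : ℝ} (hx : 0 ≤ x) :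
    ∫ t in (0 : ℝ)..x, t ^ a * (x - t) ^ b * Real.exp (w * (x - t)) =
      (Nat.factorial a * Nat.factorial b : ℝ) / Nat.factorial (a + b + 1) *
        x ^ (a + b + 1) * hyp1F1 ((b : ℝ) + 1) (((a + b + 1 : ℕ) : ℝ) + 1) (w * x) := by
  have key : HasSum
      (fun n : ℕ => ∫ t in (0 : ℝ)..x,
        t ^ a * (x - t) ^ b * ((w * (x - t)) ^ n / Nat.factorial n))
      (∫ t in (0 : ℝ)..x, t ^ a * (x - t) ^ b * Real.exp (w * (x - t))) := by
    refine intervalIntegral.hasSum_integral_of_dominated_convergence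
      (fun n _ => x ^ a * x ^ b * ((|w| * x) ^ n / Nat.factorial n))
      (fun n => Continuous.aestronglyMeasurable (by fun_prop)) ?_ ?_ ?_ ?_
    · refine fun n => Filter.Eventually.of_forall fun t ht => ?_
      rw [Set.uIoc_of_le hx] at ht
      have h0 : 0 ≤ x - t := sub_nonneg.2 ht.2
      have h1 : x - t ≤ x := by linarith [ht.1]
      have h2 : 0 ≤ t := ht.1.le
      have h3 : t ≤ x := ht.2
      simp only [norm_mul, norm_div, norm_pow, Real.norm_eq_abs, abs_of_nonneg h0,
        abs_of_nonneg h2, Nat.abs_cast]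
      gcongr
    · exact Filter.Eventually.of_forall fun t _ =>
        (Real.summable_pow_div_factorial (|w| * x)).mul_left _
    · exact intervalIntegrable_const
    · refine Filter.Eventually.of_forall fun t _ => HasSum.mul_left _ ?_
      rw [Real.exp_eq_exp_ℝ]
      exact NormedSpace.expSeries_div_hasSum_exp (w * (x - t))
  rw [← key.tsum_eq, hyp1F1, ← tsum_mul_left]
  refine tsum_congr fun n => ?_
  have h : ∀ t : ℝ, t ^ a * (x - t) ^ b * ((w * (x - t)) ^ n / Nat.factorial n) =
      w ^ n / Nat.factorial n * (t ^ a * (x - t) ^ (b + n)) := fun t => by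
    rw [mul_pow, pow_add]
    ring
  simp only [h, intervalIntegral.integral_const_mul, integral_pow_mul_sub_pow,
    risingFactorial_natCast_succ]
  rw [show a + (b + n) + 1 = a + b + 1 + n by ring, mul_pow, pow_add x]
  field_simp

theorem kmuShadowed_eq_gamma_convolution (γ κ : ℝ) (hγ : 0 < γ) (hκ : 0 < κ)
    (μ m : ℕ) (hμ : 0 < μ) (hm : 0 < m) (hmμ : m < μ) (Δ₁ Δ₂ : ℝ)
    (hΔ₁ : Δ₁ = γ / (μ * (1 + κ)))
    (hΔ₂ : Δ₂ = ((μ * κ + m) / m) * (γ / (μ * (1 + κ))))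
    (x : ℝ) (hx : 0 < x) :
    ∫ t in (0 : ℝ)..x,
        (t ^ (μ - m - 1) * Real.exp (-t / Δ₁) /
          ((Nat.factorial (μ - m - 1) : ℝ) * Δ₁ ^ (μ - m))) *
        ((x - t) ^ (m - 1) * Real.exp (-(x - t) / Δ₂) /
          ((Nat.factorial (m - 1) : ℝ) * Δ₂ ^ m)) =
      kmuShadowedPDF γ κ μ m x := by
  obtain ⟨b, rfl⟩ := Nat.exists_eq_add_of_lt hm
  obtain ⟨a, rfl⟩ := Nat.exists_eq_add_of_lt hmμ
  simp only [zero_add] at *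
  have e1 : b + 1 + a + 1 - (b + 1) - 1 = a := by omega
  have e2 : b + 1 + a + 1 - (b + 1) = a + 1 := by omega
  have e3 : b + 1 + a + 1 - 1 = a + b + 1 := by omega
  have e4 : b + 1 + a + 1 = a + b + 1 + 1 := by ring
  rw [kmuShadowedPDF, e1, e2, e3, Nat.add_sub_cancel]
  rw [e4] at hΔ₁ hΔ₂ ⊢
  obtain ⟨M, hM⟩ : ∃ M : ℝ, M = ((a + b + 1 + 1 : ℕ) : ℝ) := ⟨_, rfl⟩
  obtain ⟨k, hk⟩ : ∃ k : ℝ, k = ((b + 1 : ℕ) : ℝ) := ⟨_, rfl⟩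
  have hM0 : 0 < M := by rw [hM]; positivity
  have hk0 : 0 < k := by rw [hk]; positivity
  have hF := integral_pow_mul_sub_pow_mul_exp a b (M ^ 2 * κ * (1 + κ) / ((M * κ + k) * γ)) hx.le
  rw [← Nat.cast_add_one, ← Nat.cast_add_one, ← hM, ← hk] at hF
  rw [← hM] at hΔ₁
  rw [← hM, ← hk] at hΔ₂ ⊢
  have hexp : ∀ t : ℝ, Real.exp (-t / Δ₁) * Real.exp (-(x - t) / Δ₂) =
      Real.exp (-(M * (1 + κ) * x / γ)) *
        Real.exp (M ^ 2 * κ * (1 + κ) / ((M * κ + k) * γ) * (x - t)) := fun t => by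
    rw [← Real.exp_add, ← Real.exp_add, hΔ₁, hΔ₂]
    congr 1
    field_simp
    ring
  have hint : ∀ t : ℝ, (t ^ a * Real.exp (-t / Δ₁) / ((Nat.factorial a : ℝ) * Δ₁ ^ (a + 1))) *
        ((x - t) ^ b * Real.exp (-(x - t) / Δ₂) / ((Nat.factorial b : ℝ) * Δ₂ ^ (b + 1))) =
      Real.exp (-(M * (1 + κ) * x / γ)) /
        ((Nat.factorial a : ℝ) * Δ₁ ^ (a + 1) * ((Nat.factorial b : ℝ) * Δ₂ ^ (b + 1))) *
      (t ^ a * (x - t) ^ b *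
        Real.exp (M ^ 2 * κ * (1 + κ) / ((M * κ + k) * γ) * (x - t))) := fun t => by
    rw [div_mul_div_comm, mul_mul_mul_comm, hexp]
    ring
  simp only [hint, intervalIntegral.integral_const_mul, hF]
  rw [show M ^ 2 * κ * (1 + κ) / ((M * κ + k) * γ) * x =
    M ^ 2 * κ * (1 + κ) * x / ((M * κ + k) * γ) by ring, hΔ₁, hΔ₂, add_comm k]
  simp only [div_pow, mul_pow]
  field_simp
  ring
end

section
/- Let γ̄ > 0, κ > 0, let μ be a positive integer, and let s be a real number with s < μ(1+κ)/γ̄. Set Δ₁ = γ̄/(μ(1+κ)) and, for each positive integer m, Δ₂(m) = ((μκ+m)/m)·Δ₁. Then the κ-μ shadowed moment generating functions converge to the κ-μ moment generating function: lim_{m→∞} (1 − Δ₁ s)^{m−μ} / (1 − Δ₂(m) s)^m = (1 − Δ₁ s)^{−μ} · exp(μκ Δ₁ s / (1 − Δ₁ s)). -/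
open Filter

theorem kmuShadowed_mgf_tendsto_kmu_mgf (γ κ : ℝ) (hγ : 0 < γ) (hκ : 0 < κ)
    (μ : ℕ) (hμ : 0 < μ) (s : ℝ) (hs : s < μ * (1 + κ) / γ)
    (Δ₁ : ℝ) (hΔ₁ : Δ₁ = γ / (μ * (1 + κ)))
    (Δ₂ : ℕ → ℝ) (hΔ₂ : ∀ m : ℕ, Δ₂ m = ((μ * κ + m) / m) * Δ₁) :
    Filter.Tendsto (fun m : ℕ => (1 - Δ₁ * s) ^ ((m : ℤ) - μ) / (1 - Δ₂ m * s) ^ m)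
      Filter.atTop
      (nhds ((1 - Δ₁ * s) ^ (-(μ : ℤ)) * Real.exp (μ * κ * Δ₁ * s / (1 - Δ₁ * s)))) := by
  have hD : 0 < (μ : ℝ) * (1 + κ) := by positivity
  have ha : 0 < 1 - Δ₁ * s := by
    have h : s * γ < μ * (1 + κ) := (lt_div_iff₀ hγ).mp hs
    rw [sub_pos, hΔ₁, div_mul_eq_mul_div, div_lt_one hD]
    linarith
  set a := 1 - Δ₁ * s with ha_def
  set c := μ * κ * Δ₁ * s / a
  have hlim : Tendsto (fun m : ℕ => ((1 + -c / m) ^ m)⁻¹) atTop (nhds (Real.exp c)) := by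
    simpa [Real.exp_neg] using
      (Real.tendsto_one_add_div_pow_exp (-c)).inv₀ (Real.exp_ne_zero _)
  refine (hlim.const_mul (a ^ (-(μ : ℤ)))).congr' ?_
  filter_upwards [eventually_gt_atTop 0] with m hm
  have hm' : (m : ℝ) ≠ 0 := by positivity
  have hfac : 1 - Δ₂ m * s = a * (1 + -c / m) := by
    have hca : c * a = μ * κ * Δ₁ * s := div_mul_cancel₀ _ ha.ne'
    rw [hΔ₂]
    field_simp
    linear_combination hca - m * ha_def
  rw [hfac, mul_pow, sub_eq_add_neg, zpow_add₀ ha.ne', zpow_natCast]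
  rw [mul_div_mul_left _ _ (pow_ne_zero m ha.ne'), ← div_eq_mul_inv]
end

section
/- Let γ̄ > 0, κ > 0 and let μ be a positive integer. For each positive integer m, let f_S(γ̄; κ, μ, m; ·) denote the κ-μ shadowed density, and let f_KM denote the κ-μ density with the same parameters γ̄, κ, μ. Then for every bounded continuous function Φ : ℝ → ℝ, lim_{m→∞} ∫₀^∞ Φ(t) f_S(γ̄; κ, μ, m; t) dt = ∫₀^∞ Φ(t) f_KM(t) dt. -/
open Real MeasureTheory Finset

/-- Modified Bessel function of the first kind of nonnegative integer order. -/
noncomputable def besselI (ν : ℕ) (z : ℝ) : ℝ :=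
  ∑' k : ℕ, (z / 2) ^ (2 * k + ν) / ((Nat.factorial k : ℝ) * (Nat.factorial (k + ν) : ℝ))

/-- The κ-μ density with integer parameter μ. -/
noncomputable def kmuPDF (γ κ : ℝ) (μ : ℕ) (t : ℝ) : ℝ :=
  ((μ : ℝ) * (1 + κ) ^ (((μ : ℝ) + 1) / 2) /
      (γ * κ ^ (((μ : ℝ) - 1) / 2) * Real.exp (μ * κ))) *
    (t / γ) ^ (((μ : ℝ) - 1) / 2) * Real.exp (-(μ * (1 + κ) * t / γ)) *
    besselI (μ - 1) (2 * μ * Real.sqrt (κ * (1 + κ) * t / γ))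

lemma risingFactorial_natCast (m n : ℕ) : risingFactorial m n = (m.ascFactorial n : ℝ) := by
  simp [risingFactorial, Nat.ascFactorial_eq_prod_range]

lemma risingFactorial_pos {a : ℝ} (ha : 0 < a) (n : ℕ) : 0 < risingFactorial a n :=
  Finset.prod_pos fun i _ => by positivity

lemma factorial_le_risingFactorial {μ : ℕ} (hμ : 0 < μ) (n : ℕ) :
    (n.factorial : ℝ) ≤ risingFactorial μ n := by
  rw [risingFactorial_natCast, ← Nat.one_ascFactorial n]
  simp only [Nat.ascFactorial_eq_prod_range]
  exact_mod_cast Finset.prod_le_prod' fun i _ => by omega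

lemma risingFactorial_le_factorial_mul_two_pow (M n : ℕ) :
    risingFactorial M n ≤ n.factorial * 2 ^ (M + n) := by
  rw [risingFactorial_natCast, Nat.ascFactorial_eq_factorial_mul_choose']
  have h : (M + n - 1).choose n ≤ 2 ^ (M + n) :=
    (Nat.choose_le_two_pow _ _).trans (Nat.pow_le_pow_right two_pos (by omega))
  exact_mod_cast Nat.mul_le_mul_left _ h

lemma risingFactorial_div_pow_le {M m : ℕ} (hM : 0 < M) (hMm : M ≤ m) {b : ℝ} (hb : 0 ≤ b)
    (n : ℕ) : risingFactorial m n / (b + m) ^ n ≤ risingFactorial M n / (M : ℝ) ^ n := by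
  have hM' : (0 : ℝ) < M := by exact_mod_cast hM
  have hMm' : (M : ℝ) ≤ m := by exact_mod_cast hMm
  have hm' : (0 : ℝ) < b + m := by linarith
  have key (a c : ℝ) : risingFactorial a n / c ^ n = ∏ i ∈ Finset.range n, (a + i) / c := by
    simp [risingFactorial, Finset.prod_div_distrib]
  rw [key, key]
  refine Finset.prod_le_prod (fun i _ => by positivity) fun i _ => ?_
  rw [div_le_div_iff₀ hm' hM']
  have hi : (0 : ℝ) ≤ i := i.cast_nonneg
  nlinarith [mul_nonneg hi (sub_nonneg.2 hMm'), mul_nonneg hb hM'.le, mul_nonneg hb hi]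

lemma risingFactorial_ratio_le {M m μ : ℕ} (hM : 0 < M) (hMm : M ≤ m) (hμ : 0 < μ) {b : ℝ}
    (hb : 0 ≤ b) (n : ℕ) :
    risingFactorial m n / (b + m) ^ n / risingFactorial μ n ≤ 2 ^ M * (2 / (M : ℝ)) ^ n := by
  have hM' : (0 : ℝ) < M := by exact_mod_cast hM
  have hn : (0 : ℝ) < n.factorial := by positivity
  rw [div_le_iff₀ (risingFactorial_pos (by exact_mod_cast hμ) n)]
  calc risingFactorial m n / (b + m) ^ n
      ≤ risingFactorial M n / (M : ℝ) ^ n := risingFactorial_div_pow_le hM hMm hb n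
    _ ≤ n.factorial * 2 ^ (M + n) / (M : ℝ) ^ n := by
        gcongr
        exact risingFactorial_le_factorial_mul_two_pow M n
    _ = 2 ^ M * (2 / (M : ℝ)) ^ n * n.factorial := by
        rw [pow_add, div_pow]
        ring
    _ ≤ _ := by
        gcongr
        exact factorial_le_risingFactorial hμ n

lemma abs_hyp1F1_term_le {M m μ : ℕ} (hM : 0 < M) (hMm : M ≤ m) (hμ : 0 < μ) {b : ℝ}
    (hb : 0 ≤ b) (y : ℝ) (n : ℕ) :
    ‖risingFactorial m n / risingFactorial μ n * (y / (b + m)) ^ n / (n.factorial : ℝ)‖ ≤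
      2 ^ M * ((2 / (M : ℝ) * |y|) ^ n / n.factorial) := by
  have hm : (0 : ℝ) < m := by exact_mod_cast hM.trans_le hMm
  have h1 := risingFactorial_pos hm n
  have h2 := risingFactorial_pos (a := (μ : ℝ)) (by exact_mod_cast hμ) n
  have e : ‖risingFactorial m n / risingFactorial μ n * (y / (b + m)) ^ n / (n.factorial : ℝ)‖ =
      risingFactorial m n / (b + m) ^ n / risingFactorial μ n * |y| ^ n / n.factorial := by
    rw [norm_div, norm_mul, norm_div, norm_pow, norm_div, Real.norm_of_nonneg h1.le,
      Real.norm_of_nonneg h2.le, Real.norm_of_nonneg (by positivity : (0 : ℝ) ≤ b + m),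
      Real.norm_of_nonneg (Nat.cast_nonneg _), Real.norm_eq_abs, div_pow]
    ring
  rw [e, mul_pow, ← mul_div_assoc, ← mul_assoc]
  gcongr
  exact risingFactorial_ratio_le hM hMm hμ hb n

lemma hasSum_pow_div_factorial (x : ℝ) :
    HasSum (fun n : ℕ => x ^ n / (n.factorial : ℝ)) (Real.exp x) := by
  rw [Real.exp_eq_exp_ℝ]
  exact NormedSpace.expSeries_div_hasSum_exp x

lemma abs_hyp1F1_le {M m μ : ℕ} (hM : 0 < M) (hMm : M ≤ m) (hμ : 0 < μ) {b : ℝ}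
    (hb : 0 ≤ b) (y : ℝ) :
    |hyp1F1 m μ (y / (b + m))| ≤ 2 ^ M * Real.exp (2 / (M : ℝ) * |y|) :=
  tsum_of_norm_bounded ((hasSum_pow_div_factorial _).mul_left _)
    (abs_hyp1F1_term_le hM hMm hμ hb y)

lemma tendsto_risingFactorial_div_pow (b : ℝ) (n : ℕ) :
    Filter.Tendsto (fun m : ℕ => risingFactorial m n / (b + m) ^ n) Filter.atTop (nhds 1) := by
  have h (i : ℕ) : Filter.Tendsto (fun m : ℕ => ((m : ℝ) + i) / (b + m))
      Filter.atTop (nhds 1) := by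
    have := (tendsto_add_mul_div_add_mul_atTop_nhds (i : ℝ) b 1 (d := (1 : ℝ)) one_ne_zero)
    simpa [add_comm] using this
  have := tendsto_finsetProd (Finset.range n) fun i _ => h i
  simpa [risingFactorial, Finset.prod_div_distrib] using this

/-- The confluent limit of `₁F₁`. -/
lemma tendsto_hyp1F1 {μ : ℕ} (hμ : 0 < μ) {b : ℝ} (hb : 0 ≤ b) (y : ℝ) :
    Filter.Tendsto (fun m : ℕ => hyp1F1 m μ (y / (b + m))) Filter.atTop
      (nhds (∑' n : ℕ, y ^ n / (risingFactorial μ n * n.factorial))) := by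
  refine tendsto_tsum_of_dominated_convergence
    ((hasSum_pow_div_factorial (2 / ((1 : ℕ) : ℝ) * |y|)).summable.mul_left (2 ^ 1)) (fun n => ?_) ?_
  · have h := (tendsto_risingFactorial_div_pow b n).mul_const
      (y ^ n / (risingFactorial μ n * n.factorial))
    rw [one_mul] at h
    refine h.congr fun m => ?_
    rw [div_pow]
    ring
  · filter_upwards [Filter.eventually_ge_atTop 1] with m hm n
    exact abs_hyp1F1_term_le one_pos hm hμ hb y n

lemma tendsto_natCast_div_add_pow {b : ℝ} (hb : 0 ≤ b) :
    Filter.Tendsto (fun m : ℕ => (m : ℝ) ^ m / ((m : ℝ) + b) ^ m) Filter.atTop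
      (nhds (Real.exp (-b))) := by
  have h := (Real.tendsto_one_add_div_pow_exp b).inv₀ (Real.exp_pos b).ne'
  rw [← Real.exp_neg] at h
  refine h.congr' ?_
  filter_upwards [Filter.eventually_gt_atTop 0] with m hm
  have hm' : (0 : ℝ) < m := by exact_mod_cast hm
  rw [← inv_pow, ← div_pow]
  congr 1
  field_simp

lemma kmuPDF_eq {γ κ : ℝ} (hγ : 0 < γ) (hκ : 0 < κ) {μ : ℕ} (hμ : 0 < μ) {x : ℝ} (hx : 0 < x) :
    kmuPDF γ κ μ x =
      ((μ : ℝ) ^ μ * (1 + κ) ^ μ / ((μ - 1).factorial * γ)) * Real.exp (-(μ * κ)) *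
        (x / γ) ^ (μ - 1) * Real.exp (-(μ * (1 + κ) * x / γ)) *
        ∑' n : ℕ, ((μ : ℝ) ^ 2 * κ * (1 + κ) * x / γ) ^ n /
          (risingFactorial μ n * n.factorial) := by
  obtain ⟨ν, rfl⟩ : ∃ ν, μ = ν + 1 := ⟨μ - 1, by omega⟩
  have hκ1 : (0 : ℝ) < 1 + κ := by linarith
  set p := (((ν + 1 : ℕ) : ℝ)) with hp
  have hp0 : 0 < p := by positivity
  have e1 : (1 + κ) ^ ((p + 1) / 2) = √(1 + κ) ^ (ν + 2) := by
    rw [Real.rpow_div_two_eq_sqrt _ hκ1.le, ← Real.rpow_natCast]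
    congr 1
    simp [hp]
    ring
  have e2 (a : ℝ) (ha : 0 ≤ a) : a ^ ((p - 1) / 2) = √a ^ ν := by
    rw [Real.rpow_div_two_eq_sqrt _ ha, ← Real.rpow_natCast]
    simp [hp]
  have e3 : √(κ * (1 + κ) * x / γ) = √κ * √(1 + κ) * √(x / γ) := by
    rw [mul_div_assoc, Real.sqrt_mul (by positivity), Real.sqrt_mul hκ.le]
  have hs1 := Real.sq_sqrt hκ.le
  have hs2 := Real.sq_sqrt hκ1.le
  have hs3 := Real.sq_sqrt (div_pos hx hγ).le
  have hterm (n : ℕ) : (2 * p * √(κ * (1 + κ) * x / γ) / 2) ^ (2 * n + ν) /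
        ((n.factorial : ℝ) * ((n + ν).factorial : ℝ)) =
      (p * √κ * √(1 + κ) * √(x / γ)) ^ ν / ν.factorial *
        ((p ^ 2 * κ * (1 + κ) * x / γ) ^ n / (risingFactorial p n * n.factorial)) := by
    have hf : ((n + ν).factorial : ℝ) = ν.factorial * risingFactorial p n := by
      rw [hp, risingFactorial_natCast, add_comm n ν, ← Nat.factorial_mul_ascFactorial]
      push_cast
      ring
    have hb : 2 * p * √(κ * (1 + κ) * x / γ) / 2 = p * √κ * √(1 + κ) * √(x / γ) := by
      rw [e3]
      ring
    have hsq : (p * √κ * √(1 + κ) * √(x / γ)) ^ 2 = p ^ 2 * κ * (1 + κ) * x / γ := by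
      rw [mul_pow, mul_pow, mul_pow, hs1, hs2, hs3]
      ring
    have hr := risingFactorial_pos hp0 n
    rw [hf, hb, pow_add, pow_mul, hsq]
    field_simp
  unfold kmuPDF besselI
  rw [← hp, Nat.add_sub_cancel, tsum_congr hterm, tsum_mul_left, e1, e2 κ hκ.le,
    e2 _ (div_pos hx hγ).le, Real.exp_neg (p * κ), pow_succ p ν]
  have hκs : 0 < √κ := Real.sqrt_pos.2 hκ
  have h1 : √(1 + κ) ^ (ν + 2) * √(1 + κ) ^ ν = (1 + κ) ^ (ν + 1) := by
    rw [← pow_add, ← hs2, ← pow_mul, hs2]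
    ring_nf
  have h2 : √(x / γ) ^ ν * √(x / γ) ^ ν = (x / γ) ^ ν := by
    rw [← mul_pow, ← sq, hs3]
  rw [← h1, ← h2]
  simp only [mul_pow]
  field_simp

lemma hyp1F1_arg_eq (γ κ : ℝ) (μ m : ℕ) (x : ℝ) :
    (μ : ℝ) ^ 2 * κ * (1 + κ) * x / (((μ : ℝ) * κ + m) * γ) =
      (μ : ℝ) ^ 2 * κ * (1 + κ) * x / γ / (μ * κ + m) := by
  rw [div_div, mul_comm γ]

lemma kmuShadowedPDF_eq (γ κ : ℝ) (μ m : ℕ) (x : ℝ) :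
    kmuShadowedPDF γ κ μ m x =
      ((μ : ℝ) ^ μ * (1 + κ) ^ μ / ((μ - 1).factorial * γ)) *
        ((m : ℝ) ^ m / ((m : ℝ) + μ * κ) ^ m) *
        (x / γ) ^ (μ - 1) * Real.exp (-(μ * (1 + κ) * x / γ)) *
        hyp1F1 m μ ((μ : ℝ) ^ 2 * κ * (1 + κ) * x / γ / (μ * κ + m)) := by
  rw [kmuShadowedPDF, hyp1F1_arg_eq]
  ring

lemma tendsto_kmuShadowedPDF {γ κ : ℝ} (hγ : 0 < γ) (hκ : 0 < κ) {μ : ℕ} (hμ : 0 < μ) {x : ℝ}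
    (hx : 0 < x) :
    Filter.Tendsto (fun m : ℕ => kmuShadowedPDF γ κ μ m x) Filter.atTop
      (nhds (kmuPDF γ κ μ x)) := by
  have hb : (0 : ℝ) ≤ μ * κ := by positivity
  simp only [kmuShadowedPDF_eq, kmuPDF_eq hγ hκ hμ hx]
  exact ((((tendsto_natCast_div_add_pow hb).const_mul _).mul_const _).mul_const _).mul
    (tendsto_hyp1F1 hμ hb _)

lemma measurable_kmuShadowedPDF (γ κ : ℝ) (μ m : ℕ) : Measurable (kmuShadowedPDF γ κ μ m) := by
  have h : Measurable (hyp1F1 m μ) := Measurable.tsum fun n => by fun_prop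
  unfold kmuShadowedPDF
  fun_prop

lemma abs_kmuShadowedPDF_le {γ κ : ℝ} (hγ : 0 < γ) (hκ : 0 < κ) {μ M m : ℕ} (hμ : 0 < μ)
    (hM : 0 < M) (hMb : 4 * (μ * κ) ≤ M) (hMm : M ≤ m) {x : ℝ} (hx : 0 < x) :
    |kmuShadowedPDF γ κ μ m x| ≤
      ((μ : ℝ) ^ μ * (1 + κ) ^ μ / ((μ - 1).factorial * γ)) * 2 ^ M / γ ^ (μ - 1) *
        (x ^ (μ - 1) * Real.exp (-(μ * (1 + κ) / (2 * γ)) * x)) := by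
  have hM' : (0 : ℝ) < M := by exact_mod_cast hM
  have hm : (0 : ℝ) < m := by exact_mod_cast hM.trans_le hMm
  have hμ' : (0 : ℝ) < μ := by exact_mod_cast hμ
  have hb : (0 : ℝ) ≤ μ * κ := by positivity
  set y := (μ : ℝ) ^ 2 * κ * (1 + κ) * x / γ with hy
  have hy0 : 0 ≤ y := by positivity
  have hF := abs_hyp1F1_le hM hMm hμ hb y
  rw [abs_of_nonneg hy0] at hF
  have hw : (m : ℝ) ^ m / ((m : ℝ) + μ * κ) ^ m ≤ 1 := by
    rw [← div_pow]
    exact pow_le_one₀ (by positivity) ((div_le_one (by positivity)).2 (by linarith))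
  have hexp : -(μ * (1 + κ) * x / γ) + 2 / (M : ℝ) * y ≤ -(μ * (1 + κ) / (2 * γ)) * x := by
    have h1 : 2 / (M : ℝ) * (μ * κ) ≤ 1 / 2 := by
      rw [div_mul_eq_mul_div, div_le_iff₀ hM']
      linarith
    have h2 : 0 ≤ μ * (1 + κ) * x / γ := by positivity
    have h3 : 2 / (M : ℝ) * y = 2 / (M : ℝ) * (μ * κ) * (μ * (1 + κ) * x / γ) := by
      rw [hy]
      ring
    have h4 : -(μ * (1 + κ) / (2 * γ)) * x = -(1 / 2 * (μ * (1 + κ) * x / γ)) := by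
      field_simp
    rw [h3, h4]
    nlinarith [mul_le_mul_of_nonneg_right h1 h2]
  rw [kmuShadowedPDF_eq, ← hy, abs_mul, abs_of_nonneg (by positivity)]
  calc _ ≤ ((μ : ℝ) ^ μ * (1 + κ) ^ μ / ((μ - 1).factorial * γ)) * 1 * (x / γ) ^ (μ - 1) *
        Real.exp (-(μ * (1 + κ) * x / γ)) * (2 ^ M * Real.exp (2 / (M : ℝ) * y)) := by gcongr
    _ = ((μ : ℝ) ^ μ * (1 + κ) ^ μ / ((μ - 1).factorial * γ)) * 2 ^ M / γ ^ (μ - 1) *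
        (x ^ (μ - 1) * Real.exp (-(μ * (1 + κ) * x / γ) + 2 / (M : ℝ) * y)) := by
        rw [Real.exp_add, div_pow]
        ring
    _ ≤ _ := by gcongr

lemma integrableOn_pow_mul_exp_neg_mul (k : ℕ) {c : ℝ} (hc : 0 < c) :
    IntegrableOn (fun x : ℝ => x ^ k * Real.exp (-c * x)) (Set.Ioi 0) := by
  have hk : (-1 : ℝ) < k := neg_one_lt_zero.trans_le k.cast_nonneg
  simpa using integrableOn_rpow_mul_exp_neg_mul_rpow hk one_pos hc

theorem kmuShadowed_expectation_tendsto_kmu_expectation (γ κ : ℝ) (hγ : 0 < γ) (hκ : 0 < κ)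
    (μ : ℕ) (hμ : 0 < μ) (Φ : ℝ → ℝ) (hΦc : Continuous Φ)
    (hΦb : ∃ C : ℝ, ∀ x : ℝ, |Φ x| ≤ C) :
    Filter.Tendsto (fun m : ℕ => ∫ t in Set.Ioi (0 : ℝ), Φ t * kmuShadowedPDF γ κ μ m t)
      Filter.atTop (nhds (∫ t in Set.Ioi (0 : ℝ), Φ t * kmuPDF γ κ μ t)) := by
  obtain ⟨C, hC⟩ := hΦb
  obtain ⟨M, hM⟩ := exists_nat_ge (max 1 (4 * (μ * κ)))
  have hM0 : 0 < M := by exact_mod_cast (le_max_left _ _).trans hM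
  have hMb : 4 * (μ * κ) ≤ M := (le_max_right _ _).trans hM
  have hμ' : (0 : ℝ) < μ := by exact_mod_cast hμ
  refine tendsto_integral_filter_of_dominated_convergence
    (fun x => C * (((μ : ℝ) ^ μ * (1 + κ) ^ μ / ((μ - 1).factorial * γ)) * 2 ^ M / γ ^ (μ - 1) *
        (x ^ (μ - 1) * Real.exp (-(μ * (1 + κ) / (2 * γ)) * x))))
    (Filter.Eventually.of_forall fun m =>
      (hΦc.measurable.mul (measurable_kmuShadowedPDF γ κ μ m)).aestronglyMeasurable) ?_
    (((integrableOn_pow_mul_exp_neg_mul (μ - 1) (by positivity)).const_mul _).const_mul _) ?_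
  · filter_upwards [Filter.eventually_ge_atTop M] with m hm
    refine (ae_restrict_iff' measurableSet_Ioi).2 (Filter.Eventually.of_forall fun x hx => ?_)
    rw [Real.norm_eq_abs, abs_mul]
    exact mul_le_mul (hC x) (abs_kmuShadowedPDF_le hγ hκ hμ hM0 hMb hm hx) (abs_nonneg _)
      ((abs_nonneg _).trans (hC x))
  · refine (ae_restrict_iff' measurableSet_Ioi).2 (Filter.Eventually.of_forall fun x hx => ?_)
    exact (tendsto_kmuShadowedPDF hγ hκ hμ hx).const_mul _
end
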